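/- arXiv:1406.2664 — 5 statements merged into one kernel-verified Lean document; each statement's English description precedes it below -/
import Mathlib

section
/- Let m₁, m₂, m₃, m₄ > 0 and let t be a real number with 0 ≤ t < (m₁+m₂+m₃+m₄)². Then ∫_{(0,∞)³} [ (m₄² + m₁²x₁ + m₂²x₂ + m₃²x₃)(1 + 1/x₁ + 1/x₂ + 1/x₃) − t ]^{−1} dx₁dx₂dx₃/(x₁x₂x₃) = 8 ∫₀^∞ x · I₀(√t · x) · K₀(m₁x)K₀(m₂x)K₀(m₃x)K₀(m₄x) dx. (Both integrals converge; the left-hand integrand is positive since (m₄²+∑mᵢ²xᵢ)(1+∑xᵢ⁻¹) ≥ (m₁+m₂+m₃+m₄)² by Cauchy–Schwarz.) -/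
open MeasureTheory

/-- Modified Bessel function of the second kind of order 0:
`K₀(y) = (1/2)∫₀^∞ exp(−(y/2)(u + 1/u)) du/u`. -/
noncomputable def K0 (y : ℝ) : ℝ :=
  (1/2) * ∫ u in Set.Ioi (0:ℝ), Real.exp (-(y/2) * (u + 1/u)) / u

/-- Modified Bessel function of the first kind of order 0:
`I₀(y) = ∑_{k≥0} (y/2)^{2k}/(k!)²`. -/
noncomputable def I0 (y : ℝ) : ℝ :=
  ∑' k : ℕ, (y/2)^(2*k) / ((Nat.factorial k : ℝ))^2

open Set ENNReal

/-- The series `∑ zᵏ/(k!)²` with values in `ℝ≥0∞`, so that `I₀(x)` is its value at `x²/4`. -/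
noncomputable def besselSeries (z : ℝ) : ℝ≥0∞ :=
  ∑' k : ℕ, ENNReal.ofReal (z ^ k / (Nat.factorial k : ℝ) ^ 2)

lemma measurable_besselSeries : Measurable besselSeries :=
  Measurable.tsum fun k => by fun_prop

lemma summable_besselSeries {z : ℝ} (hz : 0 ≤ z) :
    Summable fun k : ℕ => z ^ k / (Nat.factorial k : ℝ) ^ 2 := by
  refine Summable.of_nonneg_of_le (fun k => by positivity) (fun k => ?_)
    (Real.summable_pow_div_factorial z)
  have h : (1 : ℝ) ≤ Nat.factorial k := by exact_mod_cast Nat.factorial_pos k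
  gcongr
  nlinarith

lemma I0_nonneg (y : ℝ) : 0 ≤ I0 y :=
  tsum_nonneg fun k => div_nonneg (by rw [pow_mul]; positivity) (by positivity)

lemma ofReal_I0 (y : ℝ) : ENNReal.ofReal (I0 y) = besselSeries (y ^ 2 / 4) := by
  have e : ∀ k : ℕ, (y / 2) ^ (2 * k) = (y ^ 2 / 4) ^ k := fun k => by
    rw [pow_mul]; congr 1; ring
  simp only [I0, besselSeries, e]
  exact ENNReal.ofReal_tsum_of_nonneg (fun k => by positivity)
    (summable_besselSeries (by positivity))

lemma measurable_I0 : Measurable I0 := by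
  have : I0 = fun y => (besselSeries (y ^ 2 / 4)).toReal := by
    ext y
    rw [← ofReal_I0, ENNReal.toReal_ofReal (I0_nonneg y)]
  rw [this]
  exact (measurable_besselSeries.comp (by fun_prop)).ennreal_toReal

lemma K0_nonneg (y : ℝ) : 0 ≤ K0 y :=
  mul_nonneg (by norm_num) (setIntegral_nonneg measurableSet_Ioi fun u hu =>
    div_nonneg (Real.exp_nonneg _) (le_of_lt hu))

lemma measurable_K0 : Measurable K0 := by
  refine Measurable.const_mul ?_ _
  refine StronglyMeasurable.measurable ?_
  refine StronglyMeasurable.integral_prod_right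
    (f := fun y u : ℝ => Real.exp (-(y/2) * (u + 1/u)) / u) ?_
  refine Measurable.stronglyMeasurable ?_
  unfold Function.uncurry
  fun_prop

lemma setLIntegral_Ioi_comp_mul_left {k : ℝ} (hk : 0 < k) (f : ℝ → ℝ≥0∞) :
    ∫⁻ x in Ioi (0:ℝ), f x = ∫⁻ x in Ioi (0:ℝ), ENNReal.ofReal k * f (k * x) := by
  have h := lintegral_image_eq_lintegral_abs_deriv_mul (f := fun x => k * x) (f' := fun _ => k)
    measurableSet_Ioi (s := Ioi (0:ℝ))
    (fun x _ => by simpa using ((hasDerivAt_id x).const_mul k).hasDerivWithinAt)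
    (fun x _ y _ hxy => mul_left_cancel₀ hk.ne' hxy) f
  rwa [image_mul_left_Ioi hk, mul_zero, abs_of_pos hk] at h

lemma setLIntegral_Ioi_comp_mul_sq {c : ℝ} (hc : 0 < c) (f : ℝ → ℝ≥0∞) :
    ∫⁻ x in Ioi (0:ℝ), f x =
      ∫⁻ x in Ioi (0:ℝ), ENNReal.ofReal (2 * c * x) * f (c * x ^ 2) := by
  have h := lintegral_image_eq_lintegral_abs_deriv_mul (f := fun x => c * x ^ 2)
    (f' := fun x => 2 * c * x) measurableSet_Ioi (s := Ioi (0:ℝ))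
    (fun x _ => by
      have h := (hasDerivAt_pow 2 x).const_mul c
      have e : c * (((2 : ℕ) : ℝ) * x ^ (2 - 1)) = 2 * c * x := by norm_num; ring
      exact (e ▸ h).hasDerivWithinAt)
    (fun x hx y hy hxy => by
      have h2 : x ^ 2 = y ^ 2 := mul_left_cancel₀ hc.ne' hxy
      exact (pow_left_inj₀ (le_of_lt hx) (le_of_lt hy) two_ne_zero).1 h2) f
  have himg : (fun x : ℝ => c * x ^ 2) '' Ioi 0 = Ioi 0 := by
    ext y
    simp only [mem_image, mem_Ioi]
    constructor
    · rintro ⟨x, hx, rfl⟩; positivity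
    · intro hy
      refine ⟨√(y / c), by positivity, ?_⟩
      rw [Real.sq_sqrt (by positivity)]; field_simp
  rw [himg] at h
  rw [h]
  refine setLIntegral_congr_fun measurableSet_Ioi fun x hx => ?_
  have hx' : 0 < x := hx
  simp only [abs_of_pos (show 0 < 2 * c * x by positivity)]

lemma integrableOn_K0_integrand {y : ℝ} (hy : 0 < y) :
    IntegrableOn (fun u : ℝ => Real.exp (-(y/2) * (u + 1/u)) / u) (Ioi 0) := by
  refine Integrable.mono' ((integrable_inv_one_add_sq.const_mul (2 / y)).integrableOn)
    (Measurable.aestronglyMeasurable (by fun_prop)) ?_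
  filter_upwards [ae_restrict_mem measurableSet_Ioi] with u hu
  have hu' : 0 < u := hu
  rw [Real.norm_of_nonneg (by positivity)]
  have h : Real.exp (-(y/2) * (u + 1/u)) ≤ ((y/2) * (u + 1/u))⁻¹ := by
    rw [neg_mul, Real.exp_neg]
    gcongr
    linarith [Real.add_one_le_exp ((y/2) * (u + 1/u))]
  calc _ ≤ ((y/2) * (u + 1/u))⁻¹ / u := by gcongr
    _ = _ := by field_simp; ring

lemma lintegral_exp_eq_K0 {c d y : ℝ} (hc : 0 < c) (hy : 0 < y)
    (h : c * d = y ^ 2 / 4) :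
    ∫⁻ u in Ioi (0:ℝ), ENNReal.ofReal (Real.exp (-(c * u + d / u)) / u) =
      ENNReal.ofReal (2 * K0 y) := by
  have hd' : d = y ^ 2 / (4 * c) := by field_simp; linarith
  rw [setLIntegral_Ioi_comp_mul_left (k := y / (2 * c)) (by positivity)]
  have : 2 * K0 y = ∫ u in Ioi (0:ℝ), Real.exp (-(y/2) * (u + 1/u)) / u := by
    unfold K0; ring
  rw [this, ofReal_integral_eq_lintegral_ofReal (integrableOn_K0_integrand hy)]
  · refine setLIntegral_congr_fun measurableSet_Ioi fun u hu => ?_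
    have hu' : 0 < u := hu
    rw [← ENNReal.ofReal_mul (by positivity)]
    congr 1
    have : -(c * (y / (2 * c) * u) + d / (y / (2 * c) * u)) = -(y/2) * (u + 1/u) := by
      rw [hd']; field_simp; ring
    rw [this]
    field_simp
  · filter_upwards [ae_restrict_mem measurableSet_Ioi] with u hu
    have hu' : 0 < u := hu
    simp only [Pi.zero_apply]
    positivity

lemma lintegral_pow_mul_exp {A : ℝ} (hA : 0 < A) (k : ℕ) :
    ∫⁻ a in Ioi (0:ℝ), ENNReal.ofReal (a ^ k * Real.exp (-(a * A))) =
      ENNReal.ofReal (Nat.factorial k / A ^ (k + 1)) := by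
  have h := Real.integral_rpow_mul_exp_neg_mul_Ioi (a := k + 1) (r := A) (by positivity) hA
  have h' : ∫ a in Ioi (0:ℝ), a ^ k * Real.exp (-(a * A)) = Nat.factorial k / A ^ (k + 1) := by
    rw [Real.Gamma_nat_eq_factorial] at h
    simp only [add_sub_cancel_right, Real.rpow_natCast] at h
    rw [show ((k:ℝ) + 1) = ((k + 1 : ℕ) : ℝ) by push_cast; rfl, Real.rpow_natCast] at h
    simp only [mul_comm _ A]
    rw [h]
    rw [one_div, inv_pow, inv_mul_eq_div]
  rw [← h', ofReal_integral_eq_lintegral_ofReal]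
  · refine Integrable.of_integral_ne_zero ?_
    rw [h']
    positivity
  · filter_upwards [ae_restrict_mem measurableSet_Ioi] with u hu
    have hu' : 0 < u := hu
    simp only [Pi.zero_apply]
    positivity

lemma lintegral_besselSeries_mul_exp {A z : ℝ} (hA : 0 < A) (hz : 0 ≤ z) :
    ∫⁻ a in Ioi (0:ℝ), besselSeries (z * a) * ENNReal.ofReal (Real.exp (-(a * A))) =
      ENNReal.ofReal (Real.exp (z / A) / A) := by
  have hexp : Real.exp (z / A) / A = ∑' k : ℕ, (z / A) ^ k / Nat.factorial k / A := by
    rw [tsum_div_const, Real.exp_eq_exp_ℝ, NormedSpace.exp_eq_tsum_div]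
  rw [hexp, ENNReal.ofReal_tsum_of_nonneg (fun k => by positivity)
    ((Real.summable_pow_div_factorial _).div_const _)]
  simp only [besselSeries, ← ENNReal.tsum_mul_right]
  rw [lintegral_tsum fun k => by fun_prop]
  congr 1
  ext1 k
  have : ∀ a ∈ Ioi (0:ℝ), ENNReal.ofReal ((z * a) ^ k / (Nat.factorial k : ℝ) ^ 2) *
      ENNReal.ofReal (Real.exp (-(a * A))) = ENNReal.ofReal (z ^ k / (Nat.factorial k : ℝ) ^ 2) *
      ENNReal.ofReal (a ^ k * Real.exp (-(a * A))) := fun a ha => by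
    have ha' : 0 < a := ha
    rw [← ENNReal.ofReal_mul (by positivity), ← ENNReal.ofReal_mul (by positivity), mul_pow]
    congr 1
    ring
  rw [setLIntegral_congr_fun measurableSet_Ioi this, lintegral_const_mul _ (by fun_prop),
    lintegral_pow_mul_exp hA, ← ENNReal.ofReal_mul (by positivity)]
  congr 1
  rw [div_pow, pow_succ]
  field_simp
  ring

lemma lintegral_lintegral_besselSeries {A B t : ℝ} (hA : 0 < A) (ht0 : 0 ≤ t)
    (ht : t < A * B) :
    ∫⁻ b in Ioi (0:ℝ), ∫⁻ a in Ioi (0:ℝ),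
      besselSeries (t * b * a) * ENNReal.ofReal (Real.exp (-(a * A))) *
        ENNReal.ofReal (Real.exp (-(b * B))) = ENNReal.ofReal (A * B - t)⁻¹ := by
  have hC : 0 < B - t / A := by
    rw [sub_pos, div_lt_iff₀ hA]; linarith
  have : ∀ b ∈ Ioi (0:ℝ), ∫⁻ a in Ioi (0:ℝ),
      besselSeries (t * b * a) * ENNReal.ofReal (Real.exp (-(a * A))) *
        ENNReal.ofReal (Real.exp (-(b * B))) =
      ENNReal.ofReal A⁻¹ * ENNReal.ofReal (b ^ 0 * Real.exp (-(b * (B - t / A)))) := fun b hb => by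
    have hb' : 0 < b := hb
    rw [lintegral_mul_const' _ _ ENNReal.ofReal_ne_top,
      lintegral_besselSeries_mul_exp hA (by positivity), ← ENNReal.ofReal_mul (by positivity),
      ← ENNReal.ofReal_mul (by positivity)]
    congr 1
    rw [div_mul_eq_mul_div, ← Real.exp_add, pow_zero, one_mul, inv_mul_eq_div]
    congr 2
    ring
  rw [setLIntegral_congr_fun measurableSet_Ioi this, lintegral_const_mul _ (by fun_prop),
    lintegral_pow_mul_exp hC, ← ENNReal.ofReal_mul (by positivity)]
  congr 1
  have : A * B - t = A * (B - t / A) := by field_simp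
  rw [this]
  simp [mul_comm]

lemma lintegral_exp_factor {m₁ m₂ m₃ m₄ a b : ℝ} :
    ∫⁻ p in Ioi (0:ℝ) ×ˢ (Ioi (0:ℝ) ×ˢ Ioi (0:ℝ)),
      ENNReal.ofReal (Real.exp (-(a * (m₄^2 + m₁^2 * p.1 + m₂^2 * p.2.1 + m₃^2 * p.2.2)))) *
        ENNReal.ofReal (Real.exp (-(b * (1 + 1/p.1 + 1/p.2.1 + 1/p.2.2)))) *
        ENNReal.ofReal (p.1 * p.2.1 * p.2.2)⁻¹ =
    ENNReal.ofReal (Real.exp (-(a * m₄^2 + b))) *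
      ((∫⁻ u in Ioi (0:ℝ), ENNReal.ofReal (Real.exp (-(a * m₁^2 * u + b / u)) / u)) *
      ((∫⁻ u in Ioi (0:ℝ), ENNReal.ofReal (Real.exp (-(a * m₂^2 * u + b / u)) / u)) *
      ∫⁻ u in Ioi (0:ℝ), ENNReal.ofReal (Real.exp (-(a * m₃^2 * u + b / u)) / u))) := by
  have hm : ∀ m : ℝ, Measurable fun u : ℝ =>
      ENNReal.ofReal (Real.exp (-(a * m^2 * u + b / u)) / u) := fun m => by fun_prop
  rw [← lintegral_prod_mul (hm m₂).aemeasurable (hm m₃).aemeasurable,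
    ← lintegral_prod_mul (hm m₁).aemeasurable
      (g := fun w : ℝ × ℝ => ENNReal.ofReal (Real.exp (-(a * m₂^2 * w.1 + b / w.1)) / w.1) *
        ENNReal.ofReal (Real.exp (-(a * m₃^2 * w.2 + b / w.2)) / w.2))
      (((hm m₂).comp measurable_fst).mul ((hm m₃).comp measurable_snd)).aemeasurable,
    Measure.prod_restrict, Measure.prod_restrict,
    ← lintegral_const_mul' _ _ ENNReal.ofReal_ne_top]
  refine setLIntegral_congr_fun (measurableSet_Ioi.prod (measurableSet_Ioi.prod measurableSet_Ioi))
    fun p hp => ?_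
  obtain ⟨h1, h2, h3⟩ := hp
  have h1' : 0 < p.1 := h1
  have h2' : 0 < p.2.1 := h2
  have h3' : 0 < p.2.2 := h3
  repeat rw [← ENNReal.ofReal_mul (by positivity)]
  congr 1
  simp only [div_eq_mul_inv _ p.1, div_eq_mul_inv _ p.2.1, div_eq_mul_inv _ p.2.2, mul_inv]
  have : ∀ e₀ e₁ e₂ e₃ x y z : ℝ, Real.exp e₀ * (Real.exp e₁ * x * (Real.exp e₂ * y *
      (Real.exp e₃ * z))) = Real.exp (e₀ + e₁ + e₂ + e₃) * (x * y * z) := fun _ _ _ _ _ _ _ => by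
    simp only [Real.exp_add]; ring
  rw [this, ← Real.exp_add]
  congr 2
  ring

lemma lintegral_kernel_eq {m₁ m₂ m₃ m₄ t x b : ℝ} (h₁ : 0 < m₁) (h₂ : 0 < m₂) (h₃ : 0 < m₃)
    (ht : 0 ≤ t) (hx : 0 < x) (hb : 0 < b) :
    ENNReal.ofReal (2 * (1 / (4 * b)) * x) *
      (besselSeries (t * b * (1 / (4 * b) * x ^ 2)) *
        (ENNReal.ofReal (Real.exp (-(1 / (4 * b) * x ^ 2 * m₄^2 + b))) *
      ((∫⁻ u in Ioi (0:ℝ),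
        ENNReal.ofReal (Real.exp (-(1 / (4 * b) * x ^ 2 * m₁^2 * u + b / u)) / u)) *
      ((∫⁻ u in Ioi (0:ℝ),
        ENNReal.ofReal (Real.exp (-(1 / (4 * b) * x ^ 2 * m₂^2 * u + b / u)) / u)) *
      ∫⁻ u in Ioi (0:ℝ),
        ENNReal.ofReal (Real.exp (-(1 / (4 * b) * x ^ 2 * m₃^2 * u + b / u)) / u))))) =
    ENNReal.ofReal (4 * (x * I0 (√t * x) * (K0 (m₁ * x) * K0 (m₂ * x) * K0 (m₃ * x)))) *
      ENNReal.ofReal (Real.exp (-(1 * b + (m₄ * x) ^ 2 / 4 / b)) / b) := by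
  have hK : ∀ m : ℝ, 0 < m → ∫⁻ u in Ioi (0:ℝ),
      ENNReal.ofReal (Real.exp (-(1 / (4 * b) * x ^ 2 * m^2 * u + b / u)) / u) =
      ENNReal.ofReal (2 * K0 (m * x)) := fun m hm =>
    lintegral_exp_eq_K0 (by positivity) (by positivity) (by field_simp)
  have hI : t * b * (1 / (4 * b) * x ^ 2) = (√t * x) ^ 2 / 4 := by
    rw [mul_pow, Real.sq_sqrt ht]; field_simp
  have := I0_nonneg (√t * x)
  have := K0_nonneg (m₁ * x)
  have := K0_nonneg (m₂ * x)
  have := K0_nonneg (m₃ * x)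
  rw [hK _ h₁, hK _ h₂, hK _ h₃, hI, ← ofReal_I0]
  repeat rw [← ENNReal.ofReal_mul (by positivity)]
  congr 1
  have he : -(1 / (4 * b) * x ^ 2 * m₄ ^ 2 + b) = -(1 * b + (m₄ * x) ^ 2 / 4 / b) := by
    field_simp; ring
  rw [he]
  field_simp
  ring

lemma sq_sum_le_mul {m₁ m₂ m₃ m₄ x y z : ℝ} (hx : 0 < x) (hy : 0 < y) (hz : 0 < z) :
    (m₁ + m₂ + m₃ + m₄) ^ 2 ≤
      (m₄^2 + m₁^2 * x + m₂^2 * y + m₃^2 * z) * (1 + 1/x + 1/y + 1/z) := by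
  rw [← sub_nonneg]
  have : (m₄^2 + m₁^2 * x + m₂^2 * y + m₃^2 * z) * (1 + 1/x + 1/y + 1/z) -
      (m₁ + m₂ + m₃ + m₄) ^ 2 = (m₄ - m₁ * x) ^ 2 / x + (m₄ - m₂ * y) ^ 2 / y +
      (m₄ - m₃ * z) ^ 2 / z + (m₁ * x - m₂ * y) ^ 2 / (x * y) +
      (m₁ * x - m₃ * z) ^ 2 / (x * z) + (m₂ * y - m₃ * z) ^ 2 / (y * z) := by
    field_simp
    ring
  rw [this]
  positivity

lemma lintegral_eq_lintegral_bessel {m₁ m₂ m₃ m₄ t : ℝ} (h₁ : 0 < m₁) (h₂ : 0 < m₂)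
    (h₃ : 0 < m₃) (h₄ : 0 < m₄) (ht0 : 0 ≤ t) (ht : t < (m₁ + m₂ + m₃ + m₄)^2) :
    ∫⁻ p in Ioi (0:ℝ) ×ˢ (Ioi (0:ℝ) ×ˢ Ioi (0:ℝ)),
      ENNReal.ofReal (((m₄^2 + m₁^2 * p.1 + m₂^2 * p.2.1 + m₃^2 * p.2.2) *
        (1 + 1/p.1 + 1/p.2.1 + 1/p.2.2) - t)⁻¹ / (p.1 * p.2.1 * p.2.2)) =
    ∫⁻ x in Ioi (0:ℝ), ENNReal.ofReal (8 * (x * I0 (√t * x) *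
      (K0 (m₁*x) * K0 (m₂*x) * K0 (m₃*x) * K0 (m₄*x)))) := by
  have hbes := measurable_besselSeries
  have hI0 := measurable_I0
  have hK0 := measurable_K0
  let E : ℝ → ℝ → ℝ × ℝ × ℝ → ℝ≥0∞ := fun a b p =>
    ENNReal.ofReal (Real.exp (-(a * (m₄^2 + m₁^2 * p.1 + m₂^2 * p.2.1 + m₃^2 * p.2.2)))) *
      ENNReal.ofReal (Real.exp (-(b * (1 + 1/p.1 + 1/p.2.1 + 1/p.2.2)))) *
      ENNReal.ofReal (p.1 * p.2.1 * p.2.2)⁻¹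
  have hS : MeasurableSet (Ioi (0:ℝ) ×ˢ (Ioi (0:ℝ) ×ˢ Ioi (0:ℝ))) :=
    measurableSet_Ioi.prod (measurableSet_Ioi.prod measurableSet_Ioi)
  have hmeas : Measurable fun r : (ℝ × ℝ × ℝ) × (ℝ × ℝ) =>
      besselSeries (t * r.2.1 * r.2.2) * E r.2.2 r.2.1 r.1 := by
    refine (hbes.comp (by fun_prop)).mul ?_
    simp only [E]
    fun_prop
  calc _ = ∫⁻ p in Ioi (0:ℝ) ×ˢ (Ioi (0:ℝ) ×ˢ Ioi (0:ℝ)), ∫⁻ q : ℝ × ℝ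
        in Ioi (0:ℝ) ×ˢ Ioi (0:ℝ), besselSeries (t * q.1 * q.2) * E q.2 q.1 p := by
        refine setLIntegral_congr_fun hS fun p hp => ?_
        obtain ⟨h1, h2, h3⟩ := hp
        have h1' : 0 < p.1 := h1
        have h2' : 0 < p.2.1 := h2
        have h3' : 0 < p.2.2 := h3
        have hlt := ht.trans_le (sq_sum_le_mul (m₁ := m₁) (m₂ := m₂) (m₃ := m₃) (m₄ := m₄)
          h1' h2' h3')
        have key := lintegral_lintegral_besselSeries
          (A := m₄^2 + m₁^2 * p.1 + m₂^2 * p.2.1 + m₃^2 * p.2.2) (by positivity) ht0 hlt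
        rw [div_eq_mul_inv, ENNReal.ofReal_mul (inv_nonneg.2 (sub_nonneg.2 hlt.le)), ← key,
          Measure.volume_eq_prod, ← Measure.prod_restrict,
          lintegral_prod (fun q : ℝ × ℝ => besselSeries (t * q.1 * q.2) * E q.2 q.1 p)
            (hmeas.comp (measurable_const.prodMk measurable_id)).aemeasurable,
          ← lintegral_mul_const' _ _ ENNReal.ofReal_ne_top]
        refine lintegral_congr fun b => ?_
        rw [← lintegral_mul_const' _ _ ENNReal.ofReal_ne_top]
        refine lintegral_congr fun a => ?_
        simp only [E]
        ring
    _ = ∫⁻ q : ℝ × ℝ in Ioi (0:ℝ) ×ˢ Ioi (0:ℝ), ∫⁻ p in Ioi (0:ℝ) ×ˢ (Ioi (0:ℝ) ×ˢ Ioi (0:ℝ)),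
        besselSeries (t * q.1 * q.2) * E q.2 q.1 p :=
        lintegral_lintegral_swap hmeas.aemeasurable
    _ = ∫⁻ b in Ioi (0:ℝ), ∫⁻ a in Ioi (0:ℝ), ∫⁻ p in Ioi (0:ℝ) ×ˢ (Ioi (0:ℝ) ×ˢ Ioi (0:ℝ)),
        besselSeries (t * b * a) * E a b p := by
        rw [Measure.volume_eq_prod, ← Measure.prod_restrict, lintegral_prod]
        exact (Measurable.lintegral_prod_left' hmeas).aemeasurable
    _ = ∫⁻ b in Ioi (0:ℝ), ∫⁻ x in Ioi (0:ℝ),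
        ENNReal.ofReal (4 * (x * I0 (√t * x) * (K0 (m₁ * x) * K0 (m₂ * x) * K0 (m₃ * x)))) *
          ENNReal.ofReal (Real.exp (-(1 * b + (m₄ * x) ^ 2 / 4 / b)) / b) := by
        refine setLIntegral_congr_fun measurableSet_Ioi fun b hb => ?_
        have hb' : 0 < b := hb
        rw [setLIntegral_Ioi_comp_mul_sq (c := 1 / (4 * b)) (by positivity)]
        refine setLIntegral_congr_fun measurableSet_Ioi fun x hx => ?_
        rw [← lintegral_kernel_eq h₁ h₂ h₃ ht0 hx hb', ← lintegral_exp_factor,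
          lintegral_const_mul]
        simp only [E]
        fun_prop
    _ = ∫⁻ x in Ioi (0:ℝ), ∫⁻ b in Ioi (0:ℝ),
        ENNReal.ofReal (4 * (x * I0 (√t * x) * (K0 (m₁ * x) * K0 (m₂ * x) * K0 (m₃ * x)))) *
          ENNReal.ofReal (Real.exp (-(1 * b + (m₄ * x) ^ 2 / 4 / b)) / b) := by
        refine lintegral_lintegral_swap (Measurable.aemeasurable ?_)
        unfold Function.uncurry
        fun_prop
    _ = _ := by
        refine setLIntegral_congr_fun measurableSet_Ioi fun x hx => ?_
        have hx' : 0 < x := hx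
        have := I0_nonneg (√t * x)
        have := K0_nonneg (m₁ * x)
        have := K0_nonneg (m₂ * x)
        have := K0_nonneg (m₃ * x)
        rw [lintegral_const_mul' _ _ ENNReal.ofReal_ne_top,
          lintegral_exp_eq_K0 one_pos (show 0 < m₄ * x by positivity) (by ring),
          ← ENNReal.ofReal_mul (by positivity)]
        congr 1
        ring

lemma integrableOn_weight :
    IntegrableOn (fun x : ℝ => (((1 + x) * (1 + 1 / x)) ^ (1/3 : ℝ))⁻¹ / x) (Ioi 0) := by
  have hm : Measurable fun x : ℝ => (((1 + x) * (1 + 1 / x)) ^ (1/3 : ℝ))⁻¹ / x := by fun_prop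
  rw [← Ioc_union_Ioi_eq_Ioi zero_le_one]
  refine IntegrableOn.union ?_ ?_
  · refine Integrable.mono' (g := fun x : ℝ => x ^ (-(2/3) : ℝ)) ?_ hm.aestronglyMeasurable ?_
    · exact (intervalIntegrable_iff_integrableOn_Ioc_of_le zero_le_one).1
        (intervalIntegral.intervalIntegrable_rpow' (by norm_num))
    · filter_upwards [ae_restrict_mem measurableSet_Ioc] with x hx
      have h0 : 0 < x := hx.1
      rw [Real.norm_of_nonneg (by positivity)]
      calc _ ≤ ((x⁻¹) ^ (1/3 : ℝ))⁻¹ / x := by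
            gcongr
            rw [one_div]
            nlinarith [inv_pos.2 h0]
        _ = x ^ (1/3 : ℝ) / x ^ (1 : ℝ) := by
            rw [Real.inv_rpow h0.le, inv_inv, Real.rpow_one]
        _ = _ := by rw [← Real.rpow_sub h0]; norm_num
  · refine Integrable.mono' (integrableOn_Ioi_rpow_of_lt (a := -(4/3)) (by norm_num) one_pos)
      hm.aestronglyMeasurable ?_
    filter_upwards [ae_restrict_mem measurableSet_Ioi] with x hx
    have h0 : 0 < x := one_pos.trans hx
    rw [Real.norm_of_nonneg (by positivity)]
    calc _ ≤ (x ^ (1/3 : ℝ))⁻¹ / x := by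
          gcongr
          rw [one_div]
          nlinarith [inv_pos.2 h0, mul_inv_cancel₀ h0.ne']
      _ = x ^ (-(1/3) : ℝ) / x ^ (1 : ℝ) := by
          rw [Real.rpow_neg h0.le, Real.rpow_one]
      _ = _ := by rw [← Real.rpow_sub h0]; norm_num

lemma mul_weight_le {x y z : ℝ} (hx : 0 < x) (hy : 0 < y) (hz : 0 < z) :
    ((1 + x) * (1 + 1 / x)) ^ (1/3 : ℝ) * (((1 + y) * (1 + 1 / y)) ^ (1/3 : ℝ) *
      ((1 + z) * (1 + 1 / z)) ^ (1/3 : ℝ)) ≤ (1 + x + y + z) * (1 + 1/x + 1/y + 1/z) := by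
  have key : ∀ a b c : ℝ, 0 < a → 0 < b → 0 < c →
      (1 + a) * (1 + b) * (1 + c) ≤ (1 + a + b + c) ^ 3 := fun a b c ha hb hc => by
    have h : (1 + a) * (1 + b) ≤ (1 + a + b + c) * (1 + a + b + c) := by
      apply mul_le_mul <;> linarith
    rw [pow_succ, pow_two]
    apply mul_le_mul h <;> first | linarith | positivity
  have hcube : ∀ w : ℝ, 0 ≤ w → (w ^ (1/3 : ℝ)) ^ 3 = w := fun w hw => by
    rw [← Real.rpow_natCast, ← Real.rpow_mul hw]; norm_num
  refine le_of_pow_le_pow_left₀ three_ne_zero (by positivity) ?_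
  rw [mul_pow, mul_pow, mul_pow, hcube _ (by positivity), hcube _ (by positivity),
    hcube _ (by positivity)]
  calc _ = ((1 + x) * (1 + y) * (1 + z)) * ((1 + 1/x) * (1 + 1/y) * (1 + 1/z)) := by ring
    _ ≤ _ := mul_le_mul (key x y z hx hy hz) (key _ _ _ (by positivity) (by positivity)
        (by positivity)) (by positivity) (by positivity)

lemma integrableOn_momentum {m₁ m₂ m₃ m₄ t : ℝ} (h₁ : 0 < m₁) (h₂ : 0 < m₂)
    (h₃ : 0 < m₃) (h₄ : 0 < m₄) (ht0 : 0 ≤ t) (ht : t < (m₁ + m₂ + m₃ + m₄)^2) :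
    IntegrableOn (fun p : ℝ × ℝ × ℝ =>
      ((m₄^2 + m₁^2 * p.1 + m₂^2 * p.2.1 + m₃^2 * p.2.2) *
        (1 + 1/p.1 + 1/p.2.1 + 1/p.2.2) - t)⁻¹ / (p.1 * p.2.1 * p.2.2))
      (Ioi (0:ℝ) ×ˢ (Ioi (0:ℝ) ×ˢ Ioi (0:ℝ))) volume := by
  obtain ⟨c, hc, hc1, hc2, hc3, hc4⟩ : ∃ c : ℝ, 0 < c ∧ c ≤ m₁^2 ∧ c ≤ m₂^2 ∧ c ≤ m₃^2 ∧
      c ≤ m₄^2 :=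
    ⟨min (min (m₁^2) (m₂^2)) (min (m₃^2) (m₄^2)), by positivity, by simp, by simp, by simp,
      by simp⟩
  have hM : 0 < (m₁ + m₂ + m₃ + m₄)^2 := by positivity
  set δ := 1 - t / (m₁ + m₂ + m₃ + m₄)^2 with hδ
  have hδ0 : 0 < δ := by rw [hδ, sub_pos, div_lt_one hM]; exact ht
  have hw := integrableOn_weight
  have hg := ((Integrable.mul_prod hw (Integrable.mul_prod hw hw)).const_mul (δ * c)⁻¹)
  rw [Measure.prod_restrict, Measure.prod_restrict] at hg
  refine Integrable.mono' hg (Measurable.aestronglyMeasurable (by fun_prop)) ?_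
  filter_upwards [ae_restrict_mem
    (measurableSet_Ioi.prod (measurableSet_Ioi.prod measurableSet_Ioi))] with p hp
  obtain ⟨x, y, z⟩ := p
  obtain ⟨h1, h2, h3⟩ := hp
  have hx : 0 < x := h1
  have hy : 0 < y := h2
  have hz : 0 < z := h3
  simp only
  have hCS := sq_sum_le_mul (m₁ := m₁) (m₂ := m₂) (m₃ := m₃) (m₄ := m₄) hx hy hz
  have hwle := mul_weight_le hx hy hz
  set Wx := ((1 + x) * (1 + 1 / x)) ^ (1/3 : ℝ) with hWx
  set Wy := ((1 + y) * (1 + 1 / y)) ^ (1/3 : ℝ) with hWy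
  set Wz := ((1 + z) * (1 + 1 / z)) ^ (1/3 : ℝ) with hWz
  have hWx0 : 0 < Wx := by positivity
  have hWy0 : 0 < Wy := by positivity
  have hWz0 : 0 < Wz := by positivity
  have hA : c * (1 + x + y + z) ≤ m₄^2 + m₁^2 * x + m₂^2 * y + m₃^2 * z := by
    nlinarith
  have hAB : c * (Wx * (Wy * Wz)) ≤
      (m₄^2 + m₁^2 * x + m₂^2 * y + m₃^2 * z) * (1 + 1/x + 1/y + 1/z) :=
    calc _ ≤ c * ((1 + x + y + z) * (1 + 1/x + 1/y + 1/z)) := by gcongr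
      _ = c * (1 + x + y + z) * (1 + 1/x + 1/y + 1/z) := by ring
      _ ≤ _ := by gcongr
  set P := (m₄^2 + m₁^2 * x + m₂^2 * y + m₃^2 * z) * (1 + 1/x + 1/y + 1/z)
  have hP : δ * P ≤ P - t := by
    have : t ≤ t / (m₁ + m₂ + m₃ + m₄)^2 * P := by
      rw [div_mul_eq_mul_div, le_div_iff₀ hM]
      gcongr
    rw [hδ]; linarith
  have hle : δ * (c * (Wx * (Wy * Wz))) ≤ P - t :=
    (mul_le_mul_of_nonneg_left hAB hδ0.le).trans hP
  have hpos : 0 < P - t := lt_of_lt_of_le (by positivity) hle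
  rw [Real.norm_of_nonneg (by positivity)]
  calc _ ≤ (δ * (c * (Wx * (Wy * Wz))))⁻¹ / (x * y * z) := by gcongr
    _ = _ := by field_simp

theorem stmt0 (m₁ m₂ m₃ m₄ t : ℝ) (h₁ : 0 < m₁) (h₂ : 0 < m₂) (h₃ : 0 < m₃) (h₄ : 0 < m₄)
    (ht0 : 0 ≤ t) (ht : t < (m₁ + m₂ + m₃ + m₄)^2) :
    IntegrableOn (fun p : ℝ × ℝ × ℝ =>
      ((m₄^2 + m₁^2 * p.1 + m₂^2 * p.2.1 + m₃^2 * p.2.2) *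
        (1 + 1/p.1 + 1/p.2.1 + 1/p.2.2) - t)⁻¹ / (p.1 * p.2.1 * p.2.2))
      (Set.Ioi (0:ℝ) ×ˢ (Set.Ioi (0:ℝ) ×ˢ Set.Ioi (0:ℝ))) volume ∧
    IntegrableOn (fun x : ℝ =>
      x * I0 (Real.sqrt t * x) * (K0 (m₁*x) * K0 (m₂*x) * K0 (m₃*x) * K0 (m₄*x)))
      (Set.Ioi (0:ℝ)) volume ∧
    (∫ p in Set.Ioi (0:ℝ) ×ˢ (Set.Ioi (0:ℝ) ×ˢ Set.Ioi (0:ℝ)),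
      ((m₄^2 + m₁^2 * p.1 + m₂^2 * p.2.1 + m₃^2 * p.2.2) *
        (1 + 1/p.1 + 1/p.2.1 + 1/p.2.2) - t)⁻¹ / (p.1 * p.2.1 * p.2.2)) =
    8 * ∫ x in Set.Ioi (0:ℝ),
      x * I0 (Real.sqrt t * x) * (K0 (m₁*x) * K0 (m₂*x) * K0 (m₃*x) * K0 (m₄*x)) := by
  have hI0 := measurable_I0
  have hK0 := measurable_K0
  have hS : MeasurableSet (Ioi (0:ℝ) ×ˢ (Ioi (0:ℝ) ×ˢ Ioi (0:ℝ))) :=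
    measurableSet_Ioi.prod (measurableSet_Ioi.prod measurableSet_Ioi)
  have hL := integrableOn_momentum h₁ h₂ h₃ h₄ ht0 ht
  have heq := lintegral_eq_lintegral_bessel h₁ h₂ h₃ h₄ ht0 ht
  have hLnn : 0 ≤ᵐ[volume.restrict (Ioi (0:ℝ) ×ˢ (Ioi (0:ℝ) ×ˢ Ioi (0:ℝ)))]
      fun p : ℝ × ℝ × ℝ => ((m₄^2 + m₁^2 * p.1 + m₂^2 * p.2.1 + m₃^2 * p.2.2) *
        (1 + 1/p.1 + 1/p.2.1 + 1/p.2.2) - t)⁻¹ / (p.1 * p.2.1 * p.2.2) := by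
    filter_upwards [ae_restrict_mem hS] with p hp
    obtain ⟨h1, h2, h3⟩ := hp
    have h1' : 0 < p.1 := h1
    have h2' : 0 < p.2.1 := h2
    have h3' : 0 < p.2.2 := h3
    have hlt := ht.trans_le (sq_sum_le_mul (m₁ := m₁) (m₂ := m₂) (m₃ := m₃) (m₄ := m₄)
      h1' h2' h3')
    exact div_nonneg (inv_nonneg.2 (sub_nonneg.2 hlt.le)) (by positivity)
  have hRnn : 0 ≤ᵐ[volume.restrict (Ioi (0:ℝ))] fun x : ℝ => 8 * (x * I0 (√t * x) *
      (K0 (m₁*x) * K0 (m₂*x) * K0 (m₃*x) * K0 (m₄*x))) := by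
    filter_upwards [ae_restrict_mem measurableSet_Ioi] with x hx
    have hx' : 0 < x := hx
    have := I0_nonneg (√t * x)
    have := K0_nonneg (m₁ * x)
    have := K0_nonneg (m₂ * x)
    have := K0_nonneg (m₃ * x)
    have := K0_nonneg (m₄ * x)
    simp only [Pi.zero_apply]
    positivity
  have hRm : Measurable fun x : ℝ => 8 * (x * I0 (√t * x) *
      (K0 (m₁*x) * K0 (m₂*x) * K0 (m₃*x) * K0 (m₄*x))) := by fun_prop
  have hR : IntegrableOn (fun x : ℝ => 8 * (x * I0 (√t * x) *
      (K0 (m₁*x) * K0 (m₂*x) * K0 (m₃*x) * K0 (m₄*x)))) (Ioi 0) := by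
    refine ⟨hRm.aestronglyMeasurable, ?_⟩
    rw [hasFiniteIntegral_iff_ofReal hRnn, ← heq, ← hasFiniteIntegral_iff_ofReal hLnn]
    exact hL.2
  refine ⟨hL, ?_, ?_⟩
  · have := hR.const_mul (1/8)
    refine this.congr (ae_of_all _ fun x => ?_)
    simp only
    ring
  · rw [← integral_const_mul, integral_eq_lintegral_of_nonneg_ae hLnn hL.1,
      integral_eq_lintegral_of_nonneg_ae hRnn hR.1, heq]
end

section
/- For every τ in the upper half-plane ℍ, with q := e^{2πiτ}, the identity 16ζ(3) + ∑_{n≥1} (ψ(n)/n³)·qⁿ/(1−qⁿ) = (τ/(2πi)) · ∑_{n≥1} (ψ(n)/n²) · ∑_{m∈ℤ} 1/((m+nτ)(m−nτ)) holds, where for each n the inner sum over m ∈ ℤ converges absolutely and the outer sum over n converges absolutely. -/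
/-- The even mod-6 character `ψ` with `ψ(1)=ψ(5)=−48`, `ψ(2)=ψ(4)=720`,
`ψ(3)=384`, `ψ(6)=−5760` (6-periodic). -/
def psi (n : ℕ) : ℤ :=
  if n % 6 = 1 then -48 else if n % 6 = 2 then 720 else if n % 6 = 3 then 384
  else if n % 6 = 4 then 720 else if n % 6 = 5 then -48 else -5760

/-- `ζ(3) = ∑_{k≥1} 1/k³`. -/
noncomputable def zeta3 : ℝ := ∑' k : ℕ, 1 / ((k:ℝ)+1)^3

theorem psi_eq_sum_indicator (n : ℕ) :
    psi n = -48 + (if 2 ∣ n then 768 else 0) + (if 3 ∣ n then 432 else 0)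
      + (if 6 ∣ n then -6912 else 0) := by
  unfold psi
  split_ifs <;> omega

theorem norm_psi_le (n : ℕ) : ‖(psi n : ℂ)‖ ≤ 5760 := by
  unfold psi
  split_ifs <;> norm_num

theorem hasSum_zeta3 : HasSum (fun n : ℕ => 1 / (n : ℂ) ^ 3) (zeta3 : ℂ) := by
  have hs : Summable fun n : ℕ => 1 / (n : ℝ) ^ 3 :=
    Real.summable_one_div_nat_pow.2 (by norm_num)
  have hz : HasSum (fun n : ℕ => 1 / (n : ℝ) ^ 3) zeta3 := by
    have h := hs.tsum_eq_zero_add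
    have : zeta3 = ∑' n : ℕ, 1 / (n : ℝ) ^ 3 := by
      rw [h]
      simp [zeta3]
    rw [this]
    exact hs.hasSum
  simpa using Complex.hasSum_ofReal.2 hz

theorem hasSum_multiples_inv_cube {d : ℕ} (hd : 0 < d) :
    HasSum (fun n : ℕ => if d ∣ n then 1 / (n : ℂ) ^ 3 else 0) (zeta3 / (d : ℂ) ^ 3) := by
  have hinj : Function.Injective (fun k : ℕ => d * k) :=
    fun a b h => Nat.eq_of_mul_eq_mul_left hd h
  rw [← hinj.hasSum_iff]
  · convert! hasSum_zeta3.div_const ((d : ℂ) ^ 3) using 2 with k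
    simp [mul_pow, div_eq_mul_inv, mul_comm]
  · intro n hn
    exact if_neg fun ⟨k, hk⟩ => hn ⟨k, hk.symm⟩

theorem hasSum_psi_div_cube :
    HasSum (fun n : ℕ => (psi (n + 1) : ℂ) / ((n : ℂ) + 1) ^ 3) (32 * (zeta3 : ℂ)) := by
  have h : HasSum (fun n : ℕ => (psi n : ℂ) / (n : ℂ) ^ 3) (32 * (zeta3 : ℂ)) := by
    convert! (((hasSum_zeta3.mul_left (-48)).add
      ((hasSum_multiples_inv_cube (d := 2) (by norm_num)).mul_left 768)).add
      ((hasSum_multiples_inv_cube (d := 3) (by norm_num)).mul_left 432)).add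
      ((hasSum_multiples_inv_cube (d := 6) (by norm_num)).mul_left (-6912)) using 1
    · ext n
      rw [psi_eq_sum_indicator]
      split_ifs <;> push_cast <;> ring
    · push_cast
      ring
  simpa using (hasSum_nat_add_iff' 1).2 h

theorem hasSum_int_inv_add_mul_sub {z : ℂ} (hz : 0 < z.im) :
    HasSum (fun m : ℤ => (((m : ℂ) + z) * ((m : ℂ) - z))⁻¹)
      (Real.pi * Complex.I / z * (1 + 2 * (Complex.exp (2 * Real.pi * Complex.I * z) /
        (1 - Complex.exp (2 * Real.pi * Complex.I * z))))) := by
  have hmem : z ∈ Complex.integerComplement :=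
    UpperHalfPlane.coe_mem_integerComplement ⟨z, hz⟩
  have hz0 : z ≠ 0 := fun h => by simp [h] at hz
  have hq : 1 - Complex.exp (2 * Real.pi * Complex.I * z) ≠ 0 := by
    intro h
    have := UpperHalfPlane.norm_exp_two_pi_I_lt_one ⟨z, hz⟩
    rw [UpperHalfPlane.coe_mk, ← sub_eq_zero.1 h] at this
    simp at this
  have hcot : HasSum (fun n : ℕ => (((n : ℂ) + 1 + z) * ((n : ℂ) + 1 - z))⁻¹)
      (-(Real.pi * Complex.cot (Real.pi * z) - 1 / z) / (2 * z)) := by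
    have h := (summable_cotTerm hmem).hasSum
    rw [show ∑' n, cotTerm z n = _ from (cot_series_rep' hmem).symm] at h
    convert! h.neg.div_const (2 * z) using 2 with n
    rw [cotTerm_identity hmem,
      show (z + (n + 1)) * (z - (n + 1)) = -(((n : ℂ) + 1 + z) * ((n : ℂ) + 1 - z)) by ring]
    field_simp
  have h0 : HasSum (fun n : ℕ => (((n : ℂ) + z) * ((n : ℂ) - z))⁻¹)
      (-(Real.pi * Complex.cot (Real.pi * z) - 1 / z) / (2 * z) + -1 / z ^ 2) := by
    rw [← hasSum_nat_add_iff' 1]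
    convert! hcot using 1
    · ext n
      push_cast
      rfl
    · simp
      field_simp
      ring
  have h := HasSum.of_nat_of_neg_add_one
    (f := fun m : ℤ => (((m : ℂ) + z) * ((m : ℂ) - z))⁻¹) (by simpa only [Int.cast_natCast] using h0)
    (hcot.congr_fun fun n => by push_cast; congr 1; ring)
  convert! h using 1
  rw [Complex.cot_pi_eq_exp_ratio]
  generalize Complex.exp (2 * Real.pi * Complex.I * z) = E at hq ⊢
  field_simp
  ring_nf
  simp only [Complex.I_sq]
  ring

theorem norm_pow_div_one_sub_pow_le {q : ℂ} (hq : ‖q‖ < 1) (n : ℕ) :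
    ‖q ^ (n + 1) / (1 - q ^ (n + 1))‖ ≤ 1 / (1 - ‖q‖) := by
  have h1 : ‖q ^ (n + 1)‖ ≤ ‖q‖ := by
    rw [norm_pow]
    exact pow_le_of_le_one (norm_nonneg q) hq.le (by omega)
  have h2 : 1 - ‖q‖ ≤ ‖1 - q ^ (n + 1)‖ := by
    have := norm_sub_norm_le (1 : ℂ) (q ^ (n + 1))
    rw [norm_one] at this
    linarith
  rw [norm_div]
  exact div_le_div₀ zero_le_one (h1.trans hq.le) (by linarith) h2

theorem summable_psi_lambert {q : ℂ} (hq : ‖q‖ < 1) :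
    Summable (fun n : ℕ => (psi (n + 1) : ℂ) / ((n : ℂ) + 1) ^ 3 *
      (q ^ (n + 1) / (1 - q ^ (n + 1)))) := by
  refine .of_norm_bounded (hasSum_psi_div_cube.summable.norm.mul_right (1 / (1 - ‖q‖))) fun n => ?_
  rw [norm_mul]
  gcongr
  exact norm_pow_div_one_sub_pow_le hq n

theorem stmt10 (τ : ℂ) (hτ : 0 < τ.im) :
    (∀ n : ℕ, Summable (fun m : ℤ =>
      (((m:ℂ) + ((n:ℂ)+1)*τ) * ((m:ℂ) - ((n:ℂ)+1)*τ))⁻¹)) ∧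
    Summable (fun n : ℕ => ((psi (n+1) : ℂ) / ((n:ℂ)+1)^2) *
      ∑' m : ℤ, (((m:ℂ) + ((n:ℂ)+1)*τ) * ((m:ℂ) - ((n:ℂ)+1)*τ))⁻¹) ∧
    16 * (zeta3 : ℂ) +
      (∑' n : ℕ, ((psi (n+1) : ℂ) / ((n:ℂ)+1)^3) *
        Complex.exp (2*Real.pi*Complex.I*τ)^(n+1) /
          (1 - Complex.exp (2*Real.pi*Complex.I*τ)^(n+1))) =
    (τ / (2*Real.pi*Complex.I)) *
      ∑' n : ℕ, ((psi (n+1) : ℂ) / ((n:ℂ)+1)^2) *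
        ∑' m : ℤ, (((m:ℂ) + ((n:ℂ)+1)*τ) * ((m:ℂ) - ((n:ℂ)+1)*τ))⁻¹ := by
  have hτ0 : τ ≠ 0 := fun h => by simp [h] at hτ
  set q := Complex.exp (2 * Real.pi * Complex.I * τ) with hq_def
  have hq : ‖q‖ < 1 := UpperHalfPlane.norm_exp_two_pi_I_lt_one ⟨τ, hτ⟩
  have hinner (n : ℕ) : HasSum
      (fun m : ℤ => (((m:ℂ) + ((n:ℂ)+1)*τ) * ((m:ℂ) - ((n:ℂ)+1)*τ))⁻¹)
      (Real.pi * Complex.I / (((n:ℂ)+1)*τ) * (1 + 2 * (q ^ (n+1) / (1 - q ^ (n+1))))) := by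
    have him : 0 < (((n:ℂ)+1)*τ).im := by
      have : (((n:ℂ)+1)*τ).im = ((n:ℝ)+1)*τ.im := by simp
      rw [this]
      positivity
    have hpow : Complex.exp (2 * Real.pi * Complex.I * (((n:ℂ)+1)*τ)) = q ^ (n+1) := by
      rw [hq_def, ← Complex.exp_nat_mul]
      push_cast
      congr 1
      ring
    simpa only [hpow] using hasSum_int_inv_add_mul_sub him
  have hlambert := summable_psi_lambert hq
  have houter : HasSum (fun n : ℕ => ((psi (n+1) : ℂ) / ((n:ℂ)+1)^2) *
      ∑' m : ℤ, (((m:ℂ) + ((n:ℂ)+1)*τ) * ((m:ℂ) - ((n:ℂ)+1)*τ))⁻¹)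
      (Real.pi * Complex.I / τ * (32 * zeta3 + 2 * ∑' n : ℕ,
        (psi (n+1) : ℂ) / ((n:ℂ)+1)^3 * (q ^ (n+1) / (1 - q ^ (n+1))))) := by
    convert! (hasSum_psi_div_cube.add (hlambert.hasSum.mul_left 2)).mul_left
      (Real.pi * Complex.I / τ) using 2 with n
    rw [(hinner n).tsum_eq]
    have hn : (n:ℂ) + 1 ≠ 0 := Nat.cast_add_one_ne_zero n
    generalize q ^ (n+1) / (1 - q ^ (n+1)) = r
    field_simp
  refine ⟨fun n => (hinner n).summable, houter.summable, ?_⟩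
  rw [houter.tsum_eq]
  simp only [mul_div_assoc]
  have hpi : (Real.pi : ℂ) ≠ 0 := Complex.ofReal_ne_zero.2 Real.pi_ne_zero
  field_simp [Complex.I_ne_zero]
  ring
end

section
/- ∫_{(0,∞)³} [ (1+x+y+z)(1+1/x+1/y+1/z) ]^{−1} dx dy dz/(xyz) = 7·ζ(3). -/
open MeasureTheory

theorem lintegral_Ioi_zero_comp_mul (f : ℝ → ENNReal) {c : ℝ} (hc : 0 < c) :
    ∫⁻ y in Set.Ioi (0:ℝ), f y = ∫⁻ y in Set.Ioi (0:ℝ), ENNReal.ofReal c * f (c * y) := by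
  have him : (fun y => c * y) '' Set.Ioi (0:ℝ) = Set.Ioi 0 := by
    rw [Set.image_mul_left_Ioi hc, mul_zero]
  have h := lintegral_image_eq_lintegral_abs_deriv_mul (s := Set.Ioi (0:ℝ)) (f := fun y => c * y)
    (f' := fun _ => c) measurableSet_Ioi
    (fun x _ => by simpa using ((hasDerivAt_id x).const_mul c).hasDerivWithinAt)
    (fun x _ y _ hxy => mul_left_cancel₀ hc.ne' hxy) f
  rwa [him, abs_of_pos hc] at h

theorem lintegral_Ioi_zero_comp_two_mul_cosh_sub_two (f : ℝ → ENNReal) :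
    ∫⁻ k in Set.Ioi (0:ℝ), f k =
      ∫⁻ a in Set.Ioi (0:ℝ), ENNReal.ofReal (2 * Real.sinh a) * f (2 * Real.cosh a - 2) := by
  have him : (fun a => 2 * Real.cosh a - 2) '' Set.Ioi (0:ℝ) = Set.Ioi 0 := by
    ext k
    constructor
    · rintro ⟨a, ha, rfl⟩
      have := Real.one_lt_cosh.2 (ne_of_gt ha)
      simp only [Set.mem_Ioi]
      linarith
    · intro hk
      have hk' : 0 < k := hk
      refine ⟨Real.arcosh (k / 2 + 1), Real.arcosh_pos (by linarith), ?_⟩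
      simp only
      rw [Real.cosh_arcosh (by linarith)]
      ring
  have h := lintegral_image_eq_lintegral_abs_deriv_mul (s := Set.Ioi (0:ℝ))
    (f := fun a => 2 * Real.cosh a - 2) (f' := fun a => 2 * Real.sinh a) measurableSet_Ioi
    (fun x _ => (((Real.hasDerivAt_cosh x).const_mul 2).sub_const 2).hasDerivWithinAt)
    (fun x hx y hy hxy => Real.cosh_strictMonoOn.injOn (Set.mem_Ici_of_Ioi hx)
      (Set.mem_Ici_of_Ioi hy) (by simp only at hxy; linarith)) f
  rw [him] at h
  rw [h]
  refine setLIntegral_congr_fun measurableSet_Ioi fun a ha => ?_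
  rw [abs_of_pos (by have := Real.sinh_pos_iff.2 ha; positivity)]

theorem lintegral_Ioi_inv_quadratic_cosh {a : ℝ} (ha : 0 < a) :
    ∫⁻ x in Set.Ioi (0:ℝ), ENNReal.ofReal (((1 + x) ^ 2 + (2 * Real.cosh a - 2) * x)⁻¹) =
      ENNReal.ofReal (a / Real.sinh a) := by
  have hs : 0 < Real.sinh a := Real.sinh_pos_iff.2 ha
  have hden : ∀ x : ℝ, (1 + x) ^ 2 + (2 * Real.cosh a - 2) * x =
      (x + Real.exp (-a)) * (x + Real.exp a) := by
    intro x
    have : Real.exp (-a) * Real.exp a = 1 := by rw [← Real.exp_add]; simp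
    rw [Real.cosh_eq]
    linear_combination -this
  have hderiv : ∀ x ∈ Set.Ici (0:ℝ), HasDerivAt
      (fun x => (Real.log (x + Real.exp (-a)) - Real.log (x + Real.exp a)) / (2 * Real.sinh a))
      (((1 + x) ^ 2 + (2 * Real.cosh a - 2) * x)⁻¹) x := by
    intro x hx
    have hx' : 0 ≤ x := hx
    have h1 : x + Real.exp (-a) ≠ 0 := by positivity
    have h2 : x + Real.exp a ≠ 0 := by positivity
    have := ((((hasDerivAt_id x).add_const (Real.exp (-a))).log h1).sub
      (((hasDerivAt_id x).add_const (Real.exp a)).log h2)).div_const (2 * Real.sinh a)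
    refine this.congr_deriv ?_
    have h3 : 2 * Real.sinh a = Real.exp a - Real.exp (-a) := by rw [Real.sinh_eq]; ring
    have h4 : Real.exp a - Real.exp (-a) ≠ 0 := by rw [← h3]; positivity
    rw [hden, h3]
    simp only [id]
    field_simp
    ring
  have hpos : ∀ x ∈ Set.Ioi (0:ℝ), 0 ≤ ((1 + x) ^ 2 + (2 * Real.cosh a - 2) * x)⁻¹ := by
    intro x hx
    have hx' : 0 < x := hx
    rw [hden]
    positivity
  have hlim : Filter.Tendsto
      (fun x => (Real.log (x + Real.exp (-a)) - Real.log (x + Real.exp a)) / (2 * Real.sinh a))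
      Filter.atTop (nhds 0) := by
    have h := (Real.tendsto_log_comp_add_sub_log (Real.exp (-a))).sub
      (Real.tendsto_log_comp_add_sub_log (Real.exp a))
    have h' := h.div_const (2 * Real.sinh a)
    simpa using h'
  rw [← ofReal_integral_eq_lintegral_ofReal
    (integrableOn_Ioi_deriv_of_nonneg' hderiv hpos hlim)
    ((ae_restrict_iff' measurableSet_Ioi).2 (Filter.Eventually.of_forall hpos)),
    integral_Ioi_of_hasDerivAt_of_nonneg' hderiv hpos hlim]
  congr 1
  simp
  field_simp
  ring

theorem lintegral_Ioi_sq_mul_exp {r : ℝ} (hr : 0 < r) :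
    ∫⁻ a in Set.Ioi (0:ℝ), ENNReal.ofReal (a ^ 2 * Real.exp (-(r * a))) =
      ENNReal.ofReal (2 / r ^ 3) := by
  have key := Real.integral_rpow_mul_exp_neg_mul_Ioi (a := 3) (by norm_num) hr
  have hG : Real.Gamma 3 = 2 := by
    simp [Real.Gamma_ofNat_eq_factorial]
  have hval : ∫ a in Set.Ioi (0:ℝ), a ^ 2 * Real.exp (-(r * a)) = 2 / r ^ 3 := by
    norm_num [hG] at key
    rw [key]
    norm_cast
    field_simp
  rw [← hval]
  refine (ofReal_integral_eq_lintegral_ofReal ?_ ?_).symm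
  · exact .of_integral_ne_zero (by rw [hval]; positivity)
  · exact Filter.Eventually.of_forall fun a => by positivity

theorem hasSum_eight_div_odd_cube :
    HasSum (fun n : ℕ => 8 / (2 * (n:ℝ) + 1) ^ 3) (7 * zeta3) := by
  have hs : Summable (fun k : ℕ => 1 / ((k:ℝ) + 1) ^ 3) := by
    have := (summable_nat_add_iff 1).2 (Real.summable_one_div_nat_pow.2 (by norm_num : 1 < 3))
    simpa using this
  have hz : HasSum (fun k : ℕ => 1 / ((k:ℝ) + 1) ^ 3) zeta3 := by
    rw [zeta3]
    exact hs.hasSum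
  have hodd : HasSum (fun k : ℕ => 1 / (((2 * k + 1 : ℕ) : ℝ) + 1) ^ 3) (zeta3 / 8) := by
    have h8 : ∀ k : ℕ, 1 / (((2 * k + 1 : ℕ) : ℝ) + 1) ^ 3 = 1 / ((k:ℝ) + 1) ^ 3 / 8 := by
      intro k
      push_cast
      rw [div_div, show (2 * (k:ℝ) + 1 + 1) = 2 * (k + 1) by ring, mul_pow]
      norm_num [mul_comm]
    simp_rw [h8]
    exact hz.div_const 8
  have heven : Summable (fun k : ℕ => 1 / (((2 * k : ℕ) : ℝ) + 1) ^ 3) :=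
    hs.comp_injective (mul_right_injective₀ (two_ne_zero (α := ℕ)))
  have h : ∑' k : ℕ, 1 / (((2 * k : ℕ) : ℝ) + 1) ^ 3 + zeta3 / 8 = zeta3 :=
    (HasSum.even_add_odd (f := fun k : ℕ => 1 / ((k:ℝ) + 1) ^ 3) heven.hasSum hodd).unique hz
  have h' := heven.hasSum.mul_left 8
  rw [show 8 * ∑' k : ℕ, 1 / (((2 * k : ℕ) : ℝ) + 1) ^ 3 = 7 * zeta3 by linarith] at h'
  have h1 : ∀ k : ℕ, 8 / (2 * (k:ℝ) + 1) ^ 3 = 8 * (1 / (((2 * k : ℕ) : ℝ) + 1) ^ 3) := by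
    intro k
    push_cast
    ring
  simp_rw [h1]
  exact h'

theorem lintegral_Ioi_sq_div_sinh :
    ∫⁻ a in Set.Ioi (0:ℝ), ENNReal.ofReal (2 * a ^ 2 / Real.sinh a) =
      ENNReal.ofReal (7 * zeta3) := by
  have hexp : ∀ a ∈ Set.Ioi (0:ℝ), ENNReal.ofReal (2 * a ^ 2 / Real.sinh a) =
      ∑' n : ℕ, ENNReal.ofReal 4 *
        ENNReal.ofReal (a ^ 2 * Real.exp (-((2 * (n:ℝ) + 1) * a))) := by
    intro a ha
    have ha' : 0 < a := ha
    have hlt : Real.exp (-(2 * a)) < 1 := by rw [Real.exp_lt_one_iff]; linarith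
    have h := (hasSum_geometric_of_lt_one (Real.exp_pos _).le hlt).mul_left
      (4 * a ^ 2 * Real.exp (-a))
    have hval : 4 * a ^ 2 * Real.exp (-a) * (1 - Real.exp (-(2 * a)))⁻¹ =
        2 * a ^ 2 / Real.sinh a := by
      have h1 : Real.exp (-(2 * a)) = Real.exp (-a) * Real.exp (-a) := by
        rw [← Real.exp_add]; ring_nf
      have h2 : Real.exp a * Real.exp (-a) = 1 := by rw [← Real.exp_add]; simp
      have h3 : 0 < 1 - Real.exp (-(2 * a)) := by linarith
      have h4 : 0 < Real.sinh a := Real.sinh_pos_iff.2 ha'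
      rw [← div_eq_mul_inv, div_eq_div_iff h3.ne' h4.ne', h1, Real.sinh_eq]
      linear_combination 2 * a ^ 2 * h2
    rw [hval] at h
    rw [← h.tsum_eq, ENNReal.ofReal_tsum_of_nonneg (fun n => by positivity) h.summable]
    refine tsum_congr fun n => ?_
    rw [← ENNReal.ofReal_mul (by norm_num), ← Real.exp_nat_mul]
    congr 1
    rw [mul_assoc, ← Real.exp_add, mul_assoc]
    ring_nf
  rw [setLIntegral_congr_fun measurableSet_Ioi hexp, lintegral_tsum (fun n => by fun_prop),
    ← hasSum_eight_div_odd_cube.tsum_eq,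
    ENNReal.ofReal_tsum_of_nonneg (fun n => by positivity) hasSum_eight_div_odd_cube.summable]
  refine tsum_congr fun n => ?_
  rw [lintegral_const_mul _ (by fun_prop), lintegral_Ioi_sq_mul_exp (by positivity),
    ← ENNReal.ofReal_mul (by norm_num)]
  congr 1
  ring

theorem lintegral_Ioi_prod_inv_quadratic :
    ∫⁻ x in Set.Ioi (0:ℝ), ∫⁻ q in Set.Ioi (0:ℝ), ∫⁻ k in Set.Ioi (0:ℝ),
      ENNReal.ofReal (((1 + x) ^ 2 + k * x)⁻¹) * ENNReal.ofReal (((1 + q) ^ 2 + k * q)⁻¹) =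
      ENNReal.ofReal (7 * zeta3) := by
  have hG : Measurable fun k : ℝ =>
      ∫⁻ q in Set.Ioi (0:ℝ), ENNReal.ofReal (((1 + q) ^ 2 + k * q)⁻¹) :=
    Measurable.lintegral_prod_right' (f := fun p : ℝ × ℝ =>
      ENNReal.ofReal (((1 + p.2) ^ 2 + p.1 * p.2)⁻¹)) (by fun_prop)
  have hswap : ∀ x : ℝ, ∫⁻ q in Set.Ioi (0:ℝ), ∫⁻ k in Set.Ioi (0:ℝ),
      ENNReal.ofReal (((1 + x) ^ 2 + k * x)⁻¹) * ENNReal.ofReal (((1 + q) ^ 2 + k * q)⁻¹) =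
      ∫⁻ k in Set.Ioi (0:ℝ), ENNReal.ofReal (((1 + x) ^ 2 + k * x)⁻¹) *
        ∫⁻ q in Set.Ioi (0:ℝ), ENNReal.ofReal (((1 + q) ^ 2 + k * q)⁻¹) := by
    intro x
    rw [lintegral_lintegral_swap (by unfold Function.uncurry; fun_prop)]
    refine lintegral_congr fun k => ?_
    rw [lintegral_const_mul _ (by fun_prop)]
  simp_rw [hswap]
  rw [lintegral_lintegral_swap (by
    refine Measurable.aemeasurable (Measurable.mul ?_ (hG.comp measurable_snd))
    fun_prop)]
  rw [lintegral_congr fun k => lintegral_mul_const _ (by fun_prop),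
    lintegral_Ioi_zero_comp_two_mul_cosh_sub_two, ← lintegral_Ioi_sq_div_sinh]
  refine setLIntegral_congr_fun measurableSet_Ioi fun a ha => ?_
  have hs : 0 < Real.sinh a := Real.sinh_pos_iff.2 ha
  have ha' : 0 < a := ha
  rw [lintegral_Ioi_inv_quadratic_cosh ha, ← ENNReal.ofReal_mul (by positivity),
    ← ENNReal.ofReal_mul (by positivity)]
  congr 1
  field_simp

/-- The substitution `z = y q`, `y = k x / ((1 + x) (1 + q))` decouples `x` and `q` at fixed `k`. -/
theorem lintegral_three_banana :
    ∫⁻ x in Set.Ioi (0:ℝ), ∫⁻ y in Set.Ioi (0:ℝ), ∫⁻ z in Set.Ioi (0:ℝ),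
      ENNReal.ofReal (((1 + x + y + z) * (1 + 1/x + 1/y + 1/z))⁻¹ / (x * y * z)) =
      ENNReal.ofReal (7 * zeta3) := by
  rw [← lintegral_Ioi_prod_inv_quadratic]
  refine setLIntegral_congr_fun measurableSet_Ioi fun x hx => ?_
  have hx' : 0 < x := hx
  calc _ = ∫⁻ y in Set.Ioi (0:ℝ), ∫⁻ q in Set.Ioi (0:ℝ), ENNReal.ofReal
        (y * (((1 + x + y + y * q) * (1 + 1/x + 1/y + 1/(y * q)))⁻¹ / (x * y * (y * q)))) := by
        refine setLIntegral_congr_fun measurableSet_Ioi fun y hy => ?_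
        rw [lintegral_Ioi_zero_comp_mul _ hy]
        simp_rw [ENNReal.ofReal_mul (le_of_lt hy)]
    _ = ∫⁻ q in Set.Ioi (0:ℝ), ∫⁻ y in Set.Ioi (0:ℝ), ENNReal.ofReal
        (y * (((1 + x + y + y * q) * (1 + 1/x + 1/y + 1/(y * q)))⁻¹ / (x * y * (y * q)))) :=
        lintegral_lintegral_swap (by unfold Function.uncurry; fun_prop)
    _ = _ := by
        refine setLIntegral_congr_fun measurableSet_Ioi fun q hq => ?_
        have hq' : 0 < q := hq
        have hc : 0 < x / ((1 + q) * (1 + x)) := by positivity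
        rw [lintegral_Ioi_zero_comp_mul _ hc]
        refine setLIntegral_congr_fun measurableSet_Ioi fun k hk => ?_
        have hk' : 0 < k := hk
        rw [← ENNReal.ofReal_mul hc.le, ← ENNReal.ofReal_mul (by positivity)]
        congr 1
        have e1 : 1 + x + x / ((1 + q) * (1 + x)) * k + x / ((1 + q) * (1 + x)) * k * q =
            ((1 + x) ^ 2 + k * x) / (1 + x) := by
          field_simp
          ring
        have e2 : 1 + 1/x + 1/(x / ((1 + q) * (1 + x)) * k) +
            1/(x / ((1 + q) * (1 + x)) * k * q) =
            (1 + x) * ((1 + q) ^ 2 + k * q) / (x * k * q) := by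
          field_simp
          ring
        rw [e1, e2]
        field_simp

theorem stmt12 :
    (∫ p in Set.Ioi (0:ℝ) ×ˢ (Set.Ioi (0:ℝ) ×ˢ Set.Ioi (0:ℝ)),
      ((1 + p.1 + p.2.1 + p.2.2) * (1 + 1/p.1 + 1/p.2.1 + 1/p.2.2))⁻¹ /
        (p.1 * p.2.1 * p.2.2)) = 7 * zeta3 := by
  have hz : 0 ≤ 7 * zeta3 := hasSum_eight_div_odd_cube.nonneg fun n => by positivity
  rw [integral_eq_lintegral_of_nonneg_ae]
  · rw [← ENNReal.toReal_ofReal hz, ← lintegral_three_banana, Measure.volume_eq_prod,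
      Measure.volume_eq_prod, ← Measure.prod_restrict, ← Measure.prod_restrict,
      lintegral_prod _ (by fun_prop)]
    congr 1
    refine lintegral_congr fun x => ?_
    rw [lintegral_prod _ (by fun_prop)]
  · refine (ae_restrict_iff' (measurableSet_Ioi.prod
      (measurableSet_Ioi.prod measurableSet_Ioi))).2 (Filter.Eventually.of_forall ?_)
    rintro ⟨x, y, z⟩ ⟨hx, hy, hz⟩
    simp only [Set.mem_Ioi] at hx hy hz
    simp only [Pi.zero_apply]
    positivity
  · exact Measurable.aestronglyMeasurable (by fun_prop)
end

section
/- ∑_{m≥1} ∑_{n≥1} (ψ(n)/n²) · ( 1/(24m² − 6mn + n²) + 1/(24m² + 6mn + n²) ) = 11·ζ(4) = 11π⁴/90, where the double series converges absolutely (both quadratic forms 24m² ± 6mn + n² are positive definite). -/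
/-- The binary quadratic form `a m² + b m n + c n²` on `ℤ²`. -/
def binForm (a b c : ℝ) (p : ℤ × ℤ) : ℝ :=
  a * (p.1 : ℝ) ^ 2 + b * p.1 * p.2 + c * (p.2 : ℝ) ^ 2

/-- The sum of `1 / (n² Q(m, n))` over `ℤ²`; the terms with `n = 0` vanish by convention. -/
noncomputable def sqSum (a b c : ℝ) : ℝ :=
  ∑' p : ℤ × ℤ, ((p.2 : ℝ) ^ 2 * binForm a b c p)⁻¹

/-- The sum of `1 / (m n Q(m, n))` over `ℤ²`; the terms with `m n = 0` vanish by convention. -/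
noncomputable def mulSum (a b c : ℝ) : ℝ :=
  ∑' p : ℤ × ℤ, ((p.1 : ℝ) * p.2 * binForm a b c p)⁻¹

section PosDef

variable {a b c : ℝ}

lemma binForm_swap (p : ℤ × ℤ) : binForm c b a p.swap = binForm a b c p := by
  simp only [binForm, Prod.fst_swap, Prod.snd_swap]; ring

lemma pos_right_of_disc (ha : 0 < a) (hd : b ^ 2 < 4 * a * c) : 0 < c := by
  by_contra! h
  nlinarith [sq_nonneg b]

lemma exists_mul_le_binForm (ha : 0 < a) (hd : b ^ 2 < 4 * a * c) :
    ∃ κ > 0, ∀ p : ℤ × ℤ, κ * ((p.1 : ℝ) ^ 2 + (p.2 : ℝ) ^ 2) ≤ binForm a b c p := by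
  have hc := pos_right_of_disc ha hd
  set κ := (4 * a * c - b ^ 2) / (4 * (a + c)) with hκ
  have hκ0 : 0 < κ := div_pos (by linarith) (by linarith)
  have hκe : 4 * (a + c) * κ = 4 * a * c - b ^ 2 := by rw [hκ]; field_simp
  have hak : 0 < a - κ := by nlinarith [sq_nonneg b, mul_pos ha ha]
  refine ⟨κ, hκ0, fun ⟨m, n⟩ => ?_⟩
  simp only [binForm]
  have key : 4 * (a - κ) * (a * (m : ℝ) ^ 2 + b * m * n + c * (n : ℝ) ^ 2
      - κ * ((m : ℝ) ^ 2 + (n : ℝ) ^ 2)) = (2 * (a - κ) * m + b * n) ^ 2 + (2 * κ * n) ^ 2 := by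
    linear_combination (-(n : ℝ) ^ 2) * hκe
  have : 0 ≤ a * (m : ℝ) ^ 2 + b * m * n + c * (n : ℝ) ^ 2
      - κ * ((m : ℝ) ^ 2 + (n : ℝ) ^ 2) := by
    refine nonneg_of_mul_nonneg_right (a := 4 * (a - κ)) ?_ (by linarith)
    rw [key]; positivity
  linarith

lemma binForm_nonneg (ha : 0 < a) (hd : b ^ 2 < 4 * a * c) (p : ℤ × ℤ) :
    0 ≤ binForm a b c p := by
  obtain ⟨κ, hκ, h⟩ := exists_mul_le_binForm ha hd
  exact le_trans (by positivity) (h p)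

lemma binForm_ne_zero (ha : 0 < a) (hd : b ^ 2 < 4 * a * c) {p : ℤ × ℤ} (hp : p.2 ≠ 0) :
    binForm a b c p ≠ 0 := by
  obtain ⟨κ, hκ, h⟩ := exists_mul_le_binForm ha hd
  have : 0 < κ * ((p.1 : ℝ) ^ 2 + (p.2 : ℝ) ^ 2) := by
    have : (p.2 : ℝ) ≠ 0 := by exact_mod_cast hp
    positivity
  exact (this.trans_le (h p)).ne'

lemma summable_sq (ha : 0 < a) (hd : b ^ 2 < 4 * a * c) :
    Summable fun p : ℤ × ℤ => ((p.2 : ℝ) ^ 2 * binForm a b c p)⁻¹ := by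
  obtain ⟨κ, hκ, h⟩ := exists_mul_le_binForm ha hd
  have h2 : Summable fun n : ℤ => ((n : ℝ) ^ 2)⁻¹ := by
    simpa using Real.summable_one_div_int_pow.mpr one_lt_two
  have h1 : Summable fun n : ℤ => ((n : ℝ) ^ 2 + 1)⁻¹ := by
    refine (h2.add (hasSum_ite_eq (0 : ℤ) (1 : ℝ)).summable).of_nonneg_of_le
      (fun n => by positivity) fun n => ?_
    rcases eq_or_ne n 0 with rfl | hn
    · simp
    · have : (n : ℝ) ≠ 0 := by exact_mod_cast hn
      simp only [hn, if_false, add_zero]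
      gcongr
      linarith
  refine ((h1.mul_of_nonneg h2 (fun n => by positivity) fun n => by positivity).mul_left
    κ⁻¹).of_nonneg_of_le (fun p => inv_nonneg.mpr (mul_nonneg (sq_nonneg _)
      (binForm_nonneg ha hd p))) fun p => ?_
  rcases eq_or_ne p.2 0 with hp | hp
  · simp [hp]
  · have hz : 1 ≤ p.2 ^ 2 := by nlinarith [Int.one_le_abs hp, sq_abs p.2]
    have hn : (1 : ℝ) ≤ (p.2 : ℝ) ^ 2 := by exact_mod_cast hz
    rw [← mul_inv, ← mul_inv]
    refine inv_anti₀ (by positivity) ?_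
    have := h p
    have h3 : κ * ((p.1 : ℝ) ^ 2 + 1) ≤ κ * ((p.1 : ℝ) ^ 2 + (p.2 : ℝ) ^ 2) := by gcongr
    calc _ = (p.2 : ℝ) ^ 2 * (κ * ((p.1 : ℝ) ^ 2 + 1)) := by ring
      _ ≤ _ := by gcongr; linarith

lemma hasSum_sq (ha : 0 < a) (hd : b ^ 2 < 4 * a * c) :
    HasSum (fun p : ℤ × ℤ => ((p.2 : ℝ) ^ 2 * binForm a b c p)⁻¹) (sqSum a b c) :=
  (summable_sq ha hd).hasSum

lemma hasSum_sq_fst (ha : 0 < a) (hd : b ^ 2 < 4 * a * c) :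
    HasSum (fun p : ℤ × ℤ => ((p.1 : ℝ) ^ 2 * binForm a b c p)⁻¹) (sqSum c b a) := by
  have := (Equiv.prodComm ℤ ℤ).hasSum_iff.mpr
    (hasSum_sq (b := b) (a := c) (c := a) (pos_right_of_disc ha hd) (by linarith))
  convert this using 3 with p
  simp [binForm_swap]

lemma summable_mul (ha : 0 < a) (hd : b ^ 2 < 4 * a * c) :
    Summable fun p : ℤ × ℤ => ((p.1 : ℝ) * p.2 * binForm a b c p)⁻¹ := by
  refine Summable.of_norm_bounded ((hasSum_sq ha hd).summable.add (hasSum_sq_fst ha hd).summable)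
    fun p => ?_
  have hB := binForm_nonneg ha hd p
  rw [mul_inv, mul_inv, mul_inv, mul_inv, norm_mul, norm_mul, Real.norm_of_nonneg
    (inv_nonneg.mpr hB), ← add_mul]
  gcongr
  rw [← inv_pow, ← inv_pow, Real.norm_eq_abs, Real.norm_eq_abs]
  nlinarith [sq_nonneg (|(p.1 : ℝ)⁻¹| - |(p.2 : ℝ)⁻¹|), sq_abs (p.1 : ℝ)⁻¹, sq_abs (p.2 : ℝ)⁻¹,
    abs_nonneg (p.1 : ℝ)⁻¹, abs_nonneg (p.2 : ℝ)⁻¹]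

lemma hasSum_mul (ha : 0 < a) (hd : b ^ 2 < 4 * a * c) :
    HasSum (fun p : ℤ × ℤ => ((p.1 : ℝ) * p.2 * binForm a b c p)⁻¹) (mulSum a b c) :=
  (summable_mul ha hd).hasSum

end PosDef

section Symmetries

/-- The substitution `(m, n) ↦ (m + n, n)`. -/
def shearFst : ℤ × ℤ ≃ ℤ × ℤ where
  toFun p := (p.1 + p.2, p.2)
  invFun p := (p.1 - p.2, p.2)
  left_inv p := by simp
  right_inv p := by simp

lemma sqSum_shear (a b c : ℝ) : sqSum a (b + 2 * a) (a + b + c) = sqSum a b c := by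
  symm
  rw [sqSum, sqSum, ← shearFst.tsum_eq]
  congr! 3 with p
  simp only [binForm, shearFst, Equiv.coe_fn_mk]
  push_cast
  ring

lemma sqSum_neg (a b c : ℝ) : sqSum a (-b) c = sqSum a b c := by
  rw [sqSum, sqSum, ← ((Equiv.neg ℤ).prodCongr (Equiv.refl ℤ)).tsum_eq]
  congr! 3 with p
  simp [binForm]

lemma mulSum_neg (a b c : ℝ) : mulSum a (-b) c = -mulSum a b c := by
  rw [mulSum, mulSum, ← ((Equiv.neg ℤ).prodCongr (Equiv.refl ℤ)).tsum_eq, ← tsum_neg]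
  congr! 2 with p
  simp only [binForm, Equiv.prodCongr_apply, Prod.map, Equiv.neg_apply, Equiv.refl_apply]
  rw [← inv_neg]
  push_cast
  ring

lemma mulSum_swap (a b c : ℝ) : mulSum c b a = mulSum a b c := by
  rw [mulSum, mulSum, ← (Equiv.prodComm ℤ ℤ).tsum_eq]
  congr! 2 with p
  simp only [Equiv.prodComm_apply, binForm_swap, Prod.fst_swap, Prod.snd_swap,
    mul_comm (p.2 : ℝ)]

lemma sqSum_smul (r a b c : ℝ) : sqSum (r * a) (r * b) (r * c) = r⁻¹ * sqSum a b c := by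
  rw [sqSum, sqSum, ← tsum_mul_left]
  congr! 2 with p
  rw [← mul_inv]
  simp only [binForm]
  ring

end Symmetries

lemma hasSum_of_eq {α : Type*} {f g : α → ℝ} {s t : ℝ} (h : HasSum f s) (hf : ∀ x, g x = f x)
    (hs : t = s) : HasSum g t := by
  rwa [funext hf, hs]

section Zeta

lemma hasSum_int_of_even {f : ℤ → ℝ} {s : ℝ} (hf : ∀ n, f (-n) = f n) (h0 : f 0 = 0)
    (h : HasSum (fun n : ℕ => f n) s) : HasSum f (2 * s) := by
  have := h.of_nat_of_neg (f := f) (by simpa only [hf] using h)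
  rwa [h0, sub_zero, ← two_mul] at this

lemma hasSum_int_inv_sq : HasSum (fun n : ℤ => ((n : ℝ) ^ 2)⁻¹) (2 * (Real.pi ^ 2 / 6)) :=
  hasSum_int_of_even (by simp) (by simp) (by simpa using hasSum_zeta_two)

lemma hasSum_int_inv_pow_four :
    HasSum (fun n : ℤ => ((n : ℝ) ^ 4)⁻¹) (2 * (Real.pi ^ 4 / 90)) :=
  hasSum_int_of_even (by simp [Even.neg_pow (show Even 4 by decide)]) (by simp)
    (by simpa using hasSum_zeta_four)

lemma hasSum_inv_sq_mul_inv_sq :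
    HasSum (fun p : ℤ × ℤ => ((p.1 : ℝ) ^ 2)⁻¹ * ((p.2 : ℝ) ^ 2)⁻¹)
      (10 * (Real.pi ^ 4 / 90)) := by
  have h := hasSum_int_inv_sq
  rw [show 10 * (Real.pi ^ 4 / 90) = 2 * (Real.pi ^ 2 / 6) * (2 * (Real.pi ^ 2 / 6)) by ring]
  exact h.mul h (h.summable.mul_of_nonneg h.summable (fun n => by positivity)
    fun n => by positivity)

lemma hasSum_line_pow_four {l : ℤ → ℤ × ℤ} {π : ℤ × ℤ → ℤ} {f : ℤ × ℤ → ℝ} (r : ℝ)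
    (hl : ∀ n, π (l n) = n) (hf : ∀ p, l (π p) ≠ p → f p = 0)
    (hr : ∀ n, f (l n) = r * ((n : ℝ) ^ 4)⁻¹) : HasSum f (r * (2 * (Real.pi ^ 4 / 90))) := by
  rw [← (Function.LeftInverse.injective hl).hasSum_iff
    fun p hp => hf p fun h => hp ⟨_, h⟩]
  simpa only [Function.comp_def, hr] using hasSum_int_inv_pow_four.mul_left r

lemma hasSum_fst_eq_zero (r : ℝ) :
    HasSum (fun p : ℤ × ℤ => if p.1 = 0 then r * ((p.2 : ℝ) ^ 4)⁻¹ else 0)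
      (r * (2 * (Real.pi ^ 4 / 90))) :=
  hasSum_line_pow_four (l := fun n => (0, n)) (π := Prod.snd) r (fun _ => rfl)
    (fun p hp => if_neg fun h => hp (Prod.ext h.symm rfl)) (by simp)

lemma hasSum_snd_eq_zero (r : ℝ) :
    HasSum (fun p : ℤ × ℤ => if p.2 = 0 then r * ((p.1 : ℝ) ^ 4)⁻¹ else 0)
      (r * (2 * (Real.pi ^ 4 / 90))) :=
  hasSum_line_pow_four (l := fun n => (n, 0)) (π := Prod.fst) r (fun _ => rfl)
    (fun p hp => if_neg fun h => hp (Prod.ext rfl h.symm)) (by simp)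

lemma hasSum_add_eq_zero (r : ℝ) :
    HasSum (fun p : ℤ × ℤ => if p.1 + p.2 = 0 then r * ((p.1 : ℝ) ^ 4)⁻¹ else 0)
      (r * (2 * (Real.pi ^ 4 / 90))) :=
  hasSum_line_pow_four (l := fun n => (n, -n)) (π := Prod.fst) r (fun _ => rfl)
    (fun p hp => if_neg fun h => hp (Prod.ext rfl (by simp; omega))) (by simp)

end Zeta

section Relations

variable {a b c : ℝ}

/-- The partial fraction relation `1 / (m² n²) = (a m² + b m n + c n²) / (m² n² Q)`, summed. -/
lemma sqSum_add_mulSum_add_sqSum (ha : 0 < a) (hd : b ^ 2 < 4 * a * c) :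
    a * sqSum a b c + b * mulSum a b c + c * sqSum c b a =
      (10 + 2 * (a / c + c / a)) * (Real.pi ^ 4 / 90) := by
  have hc := pos_right_of_disc ha hd
  have h1 := (((hasSum_sq ha hd).mul_left a).add ((hasSum_mul ha hd).mul_left b)).add
    ((hasSum_sq_fst ha hd).mul_left c)
  have h2 := (hasSum_inv_sq_mul_inv_sq.add (hasSum_fst_eq_zero (a / c))).add
    (hasSum_snd_eq_zero (c / a))
  have : a * sqSum a b c + b * mulSum a b c + c * sqSum c b a =
      10 * (Real.pi ^ 4 / 90) + a / c * (2 * (Real.pi ^ 4 / 90)) +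
        c / a * (2 * (Real.pi ^ 4 / 90)) := by
    refine h1.tsum_eq.symm.trans ((tsum_congr fun ⟨m, n⟩ => ?_).trans h2.tsum_eq)
    rcases eq_or_ne m 0 with rfl | hm <;> rcases eq_or_ne n 0 with rfl | hn
    · simp
    · have : (n : ℝ) ≠ 0 := by exact_mod_cast hn
      simp [hn, binForm]
      field_simp
    · have : (m : ℝ) ≠ 0 := by exact_mod_cast hm
      simp [hm, binForm]
      field_simp
    · have hB := binForm_ne_zero ha hd (p := (m, n)) hn
      have hm' : (m : ℝ) ≠ 0 := by exact_mod_cast hm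
      have hn' : (n : ℝ) ≠ 0 := by exact_mod_cast hn
      simp only [hm, hn, if_false, add_zero]
      field_simp
      simp only [binForm]
      ring
  rw [this]
  ring

/-- The relation `1 / (m n) = 1 / (m (m + n)) + 1 / (n (m + n))`, summed against `1 / Q`. -/
lemma mulSum_add_mulSum (ha : 0 < a) (hd : b ^ 2 < 4 * a * c) :
    mulSum (a - b + c) (b - 2 * c) c + mulSum (a - b + c) (b - 2 * a) a =
      mulSum a b c + 2 * (1 / a + 1 / c + 1 / (a - b + c)) * (Real.pi ^ 4 / 90) := by
  have hc := pos_right_of_disc ha hd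
  have hs : 0 < a - b + c := by nlinarith [sq_nonneg (a - c)]
  have h1 : HasSum (fun p : ℤ × ℤ => ((p.1 : ℝ) * (p.1 + p.2) * binForm a b c p)⁻¹)
      (mulSum (a - b + c) (b - 2 * c) c) := by
    rw [← ((Equiv.prodComm ℤ ℤ).trans (shearFst.trans (Equiv.prodComm ℤ ℤ))).symm.hasSum_iff]
    convert hasSum_mul hs (b := b - 2 * c) (c := c) (by nlinarith) using 3 with p
    simp [shearFst, binForm]
    left
    ring
  have h2 : HasSum (fun p : ℤ × ℤ => ((p.2 : ℝ) * (p.1 + p.2) * binForm a b c p)⁻¹)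
      (mulSum (a - b + c) (b - 2 * a) a) := by
    rw [← mulSum_swap, ← shearFst.symm.hasSum_iff]
    convert hasSum_mul ha (b := b - 2 * a) (c := a - b + c) (by nlinarith) using 3 with p
    simp only [Function.comp_apply, shearFst, Equiv.coe_fn_symm_mk, binForm]
    push_cast
    ring
  have h3 := (((hasSum_mul ha hd).add (hasSum_fst_eq_zero (1 / c))).add
    (hasSum_snd_eq_zero (1 / a))).add (hasSum_add_eq_zero (1 / (a - b + c)))
  have : mulSum (a - b + c) (b - 2 * c) c + mulSum (a - b + c) (b - 2 * a) a =
      mulSum a b c + 1 / c * (2 * (Real.pi ^ 4 / 90)) + 1 / a * (2 * (Real.pi ^ 4 / 90)) +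
        1 / (a - b + c) * (2 * (Real.pi ^ 4 / 90)) := by
    refine (h1.add h2).tsum_eq.symm.trans ((tsum_congr fun ⟨m, n⟩ => ?_).trans h3.tsum_eq)
    rcases eq_or_ne m 0 with rfl | hm <;> rcases eq_or_ne n 0 with rfl | hn
    · simp
    · have : (n : ℝ) ≠ 0 := by exact_mod_cast hn
      simp [hn, binForm]
      field_simp
    · have : (m : ℝ) ≠ 0 := by exact_mod_cast hm
      simp [hm, binForm]
      field_simp
    · have hB := binForm_ne_zero ha hd (p := (m, n)) hn
      have hm' : (m : ℝ) ≠ 0 := by exact_mod_cast hm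
      have hn' : (n : ℝ) ≠ 0 := by exact_mod_cast hn
      rcases eq_or_ne (m + n) 0 with hmn | hmn
      · obtain rfl : n = -m := by omega
        have : a - b + c ≠ 0 := hs.ne'
        simp [hm, binForm]
        have : a * (m : ℝ) ^ 2 + -(b * m * m) + c * m ^ 2 = (a - b + c) * m ^ 2 := by ring
        rw [this]
        field_simp
        ring
      · have : (m : ℝ) + n ≠ 0 := by exact_mod_cast hmn
        simp only [hm, hn, hmn, if_false, add_zero]
        field_simp
        ring
  rw [this]
  ring

end Relations

section Hecke

variable {a b c : ℝ}

lemma hasSum_ite_of_injective {α β : Type*} {i : α → β} (hi : Function.Injective i)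
    {P : β → Prop} [DecidablePred P] (hP : ∀ y, P y ↔ y ∈ Set.range i) {f : β → ℝ} {s : ℝ}
    (h : HasSum (fun x => f (i x)) s) : HasSum (fun y => if P y then f y else 0) s := by
  rw [← hi.hasSum_iff fun y hy => if_neg fun h => hy ((hP y).mp h)]
  convert h using 2 with x
  exact if_pos ((hP _).mpr ⟨x, rfl⟩)

lemma hasSum_dvd_snd (ha : 0 < a) (hd : b ^ 2 < 4 * a * c) {d : ℤ} (hd0 : d ≠ 0) :
    HasSum (fun p : ℤ × ℤ => if d ∣ p.2 then ((p.2 : ℝ) ^ 2 * binForm a b c p)⁻¹ else 0)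
      (((d : ℝ) ^ 2)⁻¹ * sqSum a (d * b) (d ^ 2 * c)) := by
  have hd' : (0 : ℝ) < (d : ℝ) ^ 2 := by positivity
  refine hasSum_ite_of_injective (i := fun p => (p.1, d * p.2)) (fun p q h => ?_)
    (fun p => ⟨fun ⟨k, hk⟩ => ⟨(p.1, k), by simp [← hk]⟩, fun ⟨q, hq⟩ => ⟨q.2, by simp [← hq]⟩⟩) ?_
  · simp only [Prod.mk.injEq, mul_right_inj' hd0] at h
    exact Prod.ext h.1 h.2
  · refine hasSum_of_eq ((hasSum_sq (b := d * b) (c := d ^ 2 * c) ha (by nlinarith)).mul_left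
      (((d : ℝ) ^ 2)⁻¹)) (fun p => ?_) rfl
    rw [← mul_inv]
    simp only [binForm]
    push_cast
    ring

lemma hasSum_even_fst (ha : 0 < a) (hd : b ^ 2 < 4 * a * c) :
    HasSum (fun p : ℤ × ℤ => if 2 ∣ p.1 then ((p.2 : ℝ) ^ 2 * binForm a b c p)⁻¹ else 0)
      (sqSum (4 * a) (2 * b) c) := by
  refine hasSum_ite_of_injective (i := fun p => (2 * p.1, p.2)) (fun p q h => ?_)
    (fun p => ⟨fun ⟨k, hk⟩ => ⟨(k, p.2), by simp [← hk]⟩, fun ⟨q, hq⟩ => ⟨q.1, by simp [← hq]⟩⟩) ?_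
  · simp only [Prod.mk.injEq, mul_right_inj' (two_ne_zero (α := ℤ))] at h
    exact Prod.ext h.1 h.2
  · convert hasSum_sq (a := 4 * a) (b := 2 * b) (c := c) (by linarith) (by nlinarith)
      using 3 with p
    simp only [binForm]
    push_cast
    ring

lemma hasSum_even_add (ha : 0 < a) (hd : b ^ 2 < 4 * a * c) :
    HasSum (fun p : ℤ × ℤ => if 2 ∣ p.1 + p.2 then ((p.2 : ℝ) ^ 2 * binForm a b c p)⁻¹ else 0)
      (sqSum (4 * a) (4 * a + 2 * b) (a + b + c)) := by
  refine hasSum_ite_of_injective (i := fun p => (2 * p.1 + p.2, p.2)) (fun p q h => ?_)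
    (fun p => ⟨fun ⟨k, hk⟩ => ⟨(k - p.2, p.2), Prod.ext (by simp; omega) rfl⟩,
      fun ⟨q, hq⟩ => ⟨q.1 + q.2, by simp only [← hq]; ring⟩⟩) ?_
  · simp only [Prod.mk.injEq] at h
    exact Prod.ext (by omega) h.2
  · convert hasSum_sq (a := 4 * a) (b := 4 * a + 2 * b) (c := a + b + c) (by linarith)
      (by nlinarith) using 3 with p
    simp only [binForm]
    push_cast
    ring

lemma hasSum_even_even (ha : 0 < a) (hd : b ^ 2 < 4 * a * c) :
    HasSum (fun p : ℤ × ℤ => if 2 ∣ p.1 ∧ 2 ∣ p.2 then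
      ((p.2 : ℝ) ^ 2 * binForm a b c p)⁻¹ else 0) (1 / 16 * sqSum a b c) := by
  refine hasSum_ite_of_injective (i := fun p => (2 * p.1, 2 * p.2)) (fun p q h => ?_)
    (fun p => ⟨fun ⟨⟨k, hk⟩, l, hl⟩ => ⟨(k, l), by simp [← hk, ← hl]⟩,
      fun ⟨q, hq⟩ => ⟨⟨q.1, by simp [← hq]⟩, q.2, by simp [← hq]⟩⟩) ?_
  · simp only [Prod.mk.injEq, mul_right_inj' (two_ne_zero (α := ℤ))] at h
    exact Prod.ext h.1 h.2
  · refine hasSum_of_eq ((hasSum_sq ha hd).mul_left (1 / 16)) (fun p => ?_) rfl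
    rw [one_div, ← mul_inv]
    simp only [binForm]
    push_cast
    ring

/-- The Hecke relation at `2`: a vector of `ℤ²` lies in exactly one of the three sublattices of
index two, or in all three when it lies in `2ℤ²`. -/
lemma sqSum_hecke_two (ha : 0 < a) (hd : b ^ 2 < 4 * a * c) :
    1 / 4 * sqSum a (2 * b) (4 * c) + sqSum (4 * a) (2 * b) c +
      sqSum (4 * a) (4 * a + 2 * b) (a + b + c) = 9 / 8 * sqSum a b c := by
  have h1 := ((hasSum_dvd_snd ha hd two_ne_zero).add (hasSum_even_fst ha hd)).add
    (hasSum_even_add ha hd)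
  have h2 := (hasSum_sq ha hd).add ((hasSum_even_even ha hd).mul_left 2)
  have h := h1.unique (hasSum_of_eq h2 (fun p => by split_ifs <;> first | omega | ring) rfl)
  norm_num at h
  linarith

end Hecke

section Evaluation

/-- The relations between the sums attached to discriminants `-15` and `-60`. -/
lemma sqSum_combination :
    -48 * sqSum 24 6 1 + 48 * sqSum 6 3 1 + 16 * sqSum 8 6 3 - 16 * sqSum 2 3 3 =
      22 * (Real.pi ^ 4 / 90) := by
  have t1 := sqSum_hecke_two (a := 6) (b := 3) (c := 1) (by norm_num) (by norm_num)
  have t2 := sqSum_hecke_two (a := 2) (b := 3) (c := 3) (by norm_num) (by norm_num)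
  have e1 := sqSum_smul 2 3 3 2
  have e2 := sqSum_smul 2 12 15 5
  have e3 := sqSum_smul 2 1 3 6
  have e4 := sqSum_smul 2 4 7 4
  have s1 := sqSum_shear 12 (-9) 2
  have s2 := sqSum_shear 1 1 4
  have s3 := sqSum_shear 4 (-1) 1
  have s4 := sqSum_shear 2 (-1) 2
  have s5 := sqSum_shear 4 1 1
  have s6 := sqSum_shear 6 (-3) 1
  have s7 := sqSum_shear 2 1 2
  have s8 := sqSum_shear 2 5 5
  have s9 := sqSum_shear 5 5 2
  have p1 := sqSum_add_mulSum_add_sqSum (a := 1) (b := 1) (c := 4) (by norm_num) (by norm_num)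
  have p2 := sqSum_add_mulSum_add_sqSum (a := 1) (b := 3) (c := 6) (by norm_num) (by norm_num)
  have p3 := sqSum_add_mulSum_add_sqSum (a := 4) (b := 9) (c := 6) (by norm_num) (by norm_num)
  have p4 := sqSum_add_mulSum_add_sqSum (a := 4) (b := 7) (c := 4) (by norm_num) (by norm_num)
  have p5 := sqSum_add_mulSum_add_sqSum (a := 2) (b := 1) (c := 2) (by norm_num) (by norm_num)
  have p6 := sqSum_add_mulSum_add_sqSum (a := 3) (b := 3) (c := 2) (by norm_num) (by norm_num)
  have p7 := sqSum_add_mulSum_add_sqSum (a := 2) (b := 9) (c := 12) (by norm_num) (by norm_num)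
  have p8 := sqSum_add_mulSum_add_sqSum (a := 5) (b := 15) (c := 12) (by norm_num) (by norm_num)
  have p9 := sqSum_add_mulSum_add_sqSum (a := 2) (b := 5) (c := 5) (by norm_num) (by norm_num)
  have q1 := mulSum_add_mulSum (a := 1) (b := 3) (c := 6) (by norm_num) (by norm_num)
  have q2 := mulSum_add_mulSum (a := 1) (b := 1) (c := 4) (by norm_num) (by norm_num)
  have q3 := mulSum_add_mulSum (a := 2) (b := 1) (c := 2) (by norm_num) (by norm_num)
  have q4 := mulSum_add_mulSum (a := 2) (b := 9) (c := 12) (by norm_num) (by norm_num)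
  have q5 := mulSum_add_mulSum (a := 2) (b := 5) (c := 5) (by norm_num) (by norm_num)
  norm_num [sqSum_neg, mulSum_neg] at *
  rw [mulSum_swap 1 1 4] at *
  rw [mulSum_swap 2 5 5] at *
  linarith

lemma psi_natAbs (n : ℤ) : (psi n.natAbs : ℝ) =
    -48 + (if 2 ∣ n then 768 else 0) + (if 3 ∣ n then 432 else 0) +
      (if 6 ∣ n then -6912 else 0) := by
  have : psi n.natAbs = -48 + (if 2 ∣ n then 768 else 0) + (if 3 ∣ n then 432 else 0) +
      (if 6 ∣ n then -6912 else 0) := by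
    unfold psi
    split_ifs <;> omega
  exact_mod_cast this

lemma hasSum_dvd_pow_four {d : ℤ} (hd : d ≠ 0) :
    HasSum (fun n : ℤ => if d ∣ n then ((n : ℝ) ^ 4)⁻¹ else 0)
      (((d : ℝ) ^ 4)⁻¹ * (2 * (Real.pi ^ 4 / 90))) := by
  refine hasSum_ite_of_injective (i := fun n => d * n) (mul_right_injective₀ hd)
    (fun n => ⟨fun ⟨k, hk⟩ => ⟨k, hk.symm⟩, fun ⟨k, hk⟩ => ⟨k, hk.symm⟩⟩) ?_
  simpa only [Int.cast_mul, mul_pow, mul_inv] using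
    hasSum_int_inv_pow_four.mul_left (((d : ℝ) ^ 4)⁻¹)

lemma hasSum_psi_pow_four :
    HasSum (fun n : ℤ => (psi n.natAbs : ℝ) * ((n : ℝ) ^ 4)⁻¹) 0 := by
  have h := (((hasSum_int_inv_pow_four.mul_left (-48)).add
    ((hasSum_dvd_pow_four (d := 2) (by norm_num)).mul_left 768)).add
    ((hasSum_dvd_pow_four (d := 3) (by norm_num)).mul_left 432)).add
    ((hasSum_dvd_pow_four (d := 6) (by norm_num)).mul_left (-6912))
  refine hasSum_of_eq h (fun n => ?_) ?_
  · rw [psi_natAbs]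
    split_ifs <;> ring
  · push_cast
    ring

lemma hasSum_psi_binForm :
    HasSum (fun p : ℤ × ℤ => (psi p.2.natAbs : ℝ) * ((p.2 : ℝ) ^ 2 * binForm 24 6 1 p)⁻¹)
      (22 * (Real.pi ^ 4 / 90)) := by
  have ha : (0 : ℝ) < 24 := by norm_num
  have hd : (6 : ℝ) ^ 2 < 4 * 24 * 1 := by norm_num
  have h := ((((hasSum_sq ha hd).mul_left (-48)).add
    ((hasSum_dvd_snd ha hd (d := 2) (by norm_num)).mul_left 768)).add
    ((hasSum_dvd_snd ha hd (d := 3) (by norm_num)).mul_left 432)).add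
    ((hasSum_dvd_snd ha hd (d := 6) (by norm_num)).mul_left (-6912))
  refine hasSum_of_eq h (fun p => ?_) ?_
  · rw [psi_natAbs]
    split_ifs <;> ring
  · have e1 := sqSum_smul 4 6 3 1
    have e2 := sqSum_smul 3 8 6 3
    have e3 := sqSum_smul 12 2 3 3
    have := sqSum_combination
    norm_num at *
    linarith

lemma tsum_int_of_even {f : ℤ → ℝ} (hf : Summable f) (he : ∀ n, f (-n) = f n) :
    ∑' n, f n = f 0 + 2 * ∑' n : ℕ, f (n + 1) := by
  have hs : Summable fun n : ℕ => f (n + 1) :=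
    hf.comp_injective (i := fun n : ℕ => (n : ℤ) + 1) fun m n h => by simpa using h
  rw [tsum_of_add_one_of_neg_add_one hs (by simpa only [he] using hs)]
  simp only [he]
  ring

lemma tsum_int_eq_add_tsum {f : ℤ → ℝ} (hf : Summable f) :
    ∑' n, f n = f 0 + ∑' n : ℕ, (f (n + 1) + f (-(n + 1))) := by
  have h1 : Summable fun n : ℕ => f (n + 1) :=
    hf.comp_injective (i := fun n : ℕ => (n : ℤ) + 1) fun m n h => by simpa using h
  have h2 : Summable fun n : ℕ => f (-(n + 1)) :=
    hf.comp_injective (i := fun n : ℕ => -((n : ℤ) + 1)) fun m n h => by simpa using h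
  rw [tsum_of_add_one_of_neg_add_one h1 h2, h1.tsum_add h2]
  ring

end Evaluation

theorem stmt14 :
    Summable (fun p : ℕ × ℕ => ((psi (p.2+1) : ℝ) / ((p.2:ℝ)+1)^2) *
      ((24*((p.1:ℝ)+1)^2 - 6*((p.1:ℝ)+1)*((p.2:ℝ)+1) + ((p.2:ℝ)+1)^2)⁻¹ +
       (24*((p.1:ℝ)+1)^2 + 6*((p.1:ℝ)+1)*((p.2:ℝ)+1) + ((p.2:ℝ)+1)^2)⁻¹)) ∧
    (∑' m : ℕ, ∑' n : ℕ, ((psi (n+1) : ℝ) / ((n:ℝ)+1)^2) *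
      ((24*((m:ℝ)+1)^2 - 6*((m:ℝ)+1)*((n:ℝ)+1) + ((n:ℝ)+1)^2)⁻¹ +
       (24*((m:ℝ)+1)^2 + 6*((m:ℝ)+1)*((n:ℝ)+1) + ((n:ℝ)+1)^2)⁻¹)) =
    11 * (Real.pi^4 / 90) := by
  set F : ℤ × ℤ → ℝ := fun p =>
    (psi p.2.natAbs : ℝ) * ((p.2 : ℝ) ^ 2 * binForm 24 6 1 p)⁻¹ with hF
  have hsum : HasSum F (22 * (Real.pi ^ 4 / 90)) := hasSum_psi_binForm
  have hterm : ∀ m n : ℕ, ((psi (n+1) : ℝ) / ((n:ℝ)+1)^2) *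
      ((24*((m:ℝ)+1)^2 - 6*((m:ℝ)+1)*((n:ℝ)+1) + ((n:ℝ)+1)^2)⁻¹ +
       (24*((m:ℝ)+1)^2 + 6*((m:ℝ)+1)*((n:ℝ)+1) + ((n:ℝ)+1)^2)⁻¹) =
      F (m + 1, n + 1) + F (m + 1, -(n + 1)) := by
    intro m n
    have h1 : ((n : ℤ) + 1).natAbs = n + 1 := by omega
    simp only [hF, binForm, Int.natAbs_neg, h1, mul_inv]
    push_cast
    ring_nf
  have hrow : ∀ m : ℤ, Summable fun n => F (m, n) := fun m =>
    hsum.summable.comp_injective (Prod.mk_right_injective m)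
  have hneg : ∀ m : ℤ, ∑' n, F (-m, n) = ∑' n, F (m, n) := fun m => by
    rw [← (Equiv.neg ℤ).tsum_eq]
    congr! 2 with n
    simp [hF, binForm]
  have hzero : ∑' n, F (0, n) = 0 := by
    rw [← hasSum_psi_pow_four.tsum_eq]
    congr! 2 with n
    simp only [hF, binForm]
    push_cast
    ring_nf
  have hpos : ∀ m : ℕ, ∑' n, F (m + 1, n) =
      ∑' n : ℕ, (F (m + 1, n + 1) + F (m + 1, -(n + 1))) := fun m => by
    rw [tsum_int_eq_add_tsum (hrow _)]
    simp [hF]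
  simp only [hterm]
  constructor
  · refine (hsum.summable.comp_injective (i := fun p : ℕ × ℕ => ((p.1 : ℤ) + 1, (p.2 : ℤ) + 1))
      fun p q h => ?_).add (hsum.summable.comp_injective
      (i := fun p : ℕ × ℕ => ((p.1 : ℤ) + 1, -((p.2 : ℤ) + 1))) fun p q h => ?_)
    all_goals
      simp only [Prod.mk.injEq] at h
      exact Prod.ext (by omega) (by omega)
  · have h := hsum.summable.tsum_prod
    rw [hsum.tsum_eq, tsum_int_of_even hsum.summable.prod hneg, hzero] at h
    simp only [hpos] at h
    linarith
end

section
/- Let τ₀ := (−3 + i√15)/24. Then the Hauptmodul t(τ) := −( η(τ)η(3τ)/(η(2τ)η(6τ)) )⁶ satisfies t(τ₀) = 1; that is, ( η(τ₀)η(3τ₀) )⁶ = −( η(2τ₀)η(6τ₀) )⁶. -/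
/-- The Dedekind eta function `η(τ) = exp(πiτ/12)·∏_{n≥1}(1 − exp(2πinτ))`. -/
noncomputable def dedekindEta (τ : ℂ) : ℂ :=
  Complex.exp (Real.pi * Complex.I * τ / 12) *
    ∏' n : ℕ, (1 - Complex.exp (2 * Real.pi * Complex.I * ((n:ℂ)+1) * τ))

theorem dedekindEta_eq_eta (z : ℂ) : dedekindEta z = ModularForm.eta z := by
  unfold dedekindEta ModularForm.eta
  simp_rw [ModularForm.eta_q_eq_cexp]
  congr 1
  rw [Function.Periodic.qParam]
  congr 1
  push_cast
  ring

theorem dedekindEta_ne_zero {z : ℂ} (hz : 0 < z.im) : dedekindEta z ≠ 0 := by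
  rw [dedekindEta_eq_eta]
  exact ModularForm.eta_ne_zero hz

theorem Complex.sqrt_pow_six {z : ℂ} (hz : z ≠ 0) : Complex.sqrt z ^ 6 = z ^ 3 := by
  rw [_root_.sqrt_eq_exp hz, ← Complex.exp_nat_mul]
  rw [show ((6 : ℕ) : ℂ) * (Complex.log z / 2) = (3 : ℕ) * Complex.log z by push_cast; ring,
    Complex.exp_nat_mul, Complex.exp_log hz]

/-- The inversion formula for `η ^ 6`. -/
theorem dedekindEta_neg_inv_pow_six {z : ℂ} (hz : 0 < z.im) :
    dedekindEta (-1 / z) ^ 6 = Complex.I * z ^ 3 * dedekindEta z ^ 6 := by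
  have hz0 : z ≠ 0 := by rintro rfl; simp at hz
  have h := ModularForm.eta_comp_eq_csqrt_I_inv (x := z) hz
  simp only [Function.comp_apply, Pi.smul_apply, Pi.mul_apply, smul_eq_mul] at h
  rw [dedekindEta_eq_eta, dedekindEta_eq_eta, h, mul_pow, mul_pow, inv_pow,
    Complex.sqrt_pow_six hz0, Complex.sqrt_pow_six Complex.I_ne_zero, Complex.I_pow_three]
  simp [mul_assoc]

theorem dedekindEta_eq_exp_mul_tprod_pow (z : ℂ) :
    dedekindEta z = Complex.exp (Real.pi * Complex.I * z / 12) *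
      ∏' n : ℕ, (1 - Complex.exp (2 * Real.pi * Complex.I * z) ^ (n + 1)) := by
  unfold dedekindEta
  congr 2 with n
  rw [← Complex.exp_nat_mul]
  push_cast
  ring_nf

theorem dedekindEta_add_one_pow_six (z : ℂ) :
    dedekindEta (z + 1) ^ 6 = Complex.I * dedekindEta z ^ 6 := by
  have h : Complex.exp (2 * Real.pi * Complex.I * (z + 1)) =
      Complex.exp (2 * Real.pi * Complex.I * z) := by
    rw [mul_add, mul_one, Complex.exp_periodic]
  rw [dedekindEta_eq_exp_mul_tprod_pow, dedekindEta_eq_exp_mul_tprod_pow z, h, mul_pow, mul_pow,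
    ← mul_assoc]
  congr 1
  rw [← Complex.exp_nat_mul, ← Complex.exp_nat_mul]
  trans Complex.exp (Real.pi / 2 * Complex.I) *
    Complex.exp ((6 : ℕ) * (Real.pi * Complex.I * z / 12))
  · rw [← Complex.exp_add]
    push_cast
    ring_nf
  · rw [Complex.exp_pi_div_two_mul_I]

theorem dedekindEta_add_nat_pow_six (z : ℂ) (n : ℕ) :
    dedekindEta (z + n) ^ 6 = Complex.I ^ n * dedekindEta z ^ 6 := by
  induction n with
  | zero => simp
  | succ k ih => rw [Nat.cast_succ, ← add_assoc, dedekindEta_add_one_pow_six, ih]; ring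

theorem multipliable_one_sub_pow_odd {q : ℂ} (hq : ‖q‖ < 1) :
    Multipliable fun n : ℕ ↦ 1 - q ^ (2 * n + 1) := by
  have hs : Summable fun n : ℕ ↦ ‖q‖ ^ n := summable_geometric_of_lt_one (norm_nonneg _) hq
  have hinj : Function.Injective fun n : ℕ ↦ 2 * n + 1 := fun a b h ↦ by
    simpa using h
  simp_rw [sub_eq_add_neg]
  apply multipliable_one_add_of_summable
  simpa [Function.comp_def] using hs.comp_injective hinj

/-- Splitting the Euler product into its odd and even factors. -/
theorem tprod_one_sub_pow_eq_odd_mul_even {q : ℂ} (hq : ‖q‖ < 1) :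
    ∏' n : ℕ, (1 - q ^ (n + 1)) =
      (∏' n : ℕ, (1 - q ^ (2 * n + 1))) * ∏' n : ℕ, (1 - (q ^ 2) ^ (n + 1)) := by
  have hq2 : ‖q ^ 2‖ < 1 := by
    rw [norm_pow]; exact pow_lt_one₀ (norm_nonneg _) hq two_ne_zero
  have heven : ∀ n : ℕ, 1 - (q ^ 2) ^ (n + 1) = 1 - q ^ (2 * n + 1 + 1) := fun n ↦ by
    rw [← pow_mul]; ring_nf
  simp_rw [heven]
  refine (tprod_even_mul_odd (f := fun n ↦ 1 - q ^ (n + 1))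
    (multipliable_one_sub_pow_odd hq) ?_).symm
  simpa only [heven] using ModularForm.multipliable_one_sub_pow hq2

theorem tprod_one_sub_neg_pow {q : ℂ} (hq : ‖q‖ < 1) :
    (∏' n : ℕ, (1 - (-q) ^ (n + 1))) * (∏' n : ℕ, (1 - q ^ (n + 1))) *
        (∏' n : ℕ, (1 - (q ^ 4) ^ (n + 1))) =
      (∏' n : ℕ, (1 - (q ^ 2) ^ (n + 1))) ^ 3 := by
  have hq' : ‖-q‖ < 1 := by rwa [norm_neg]
  have hq2 : ‖q ^ 2‖ < 1 := by
    rw [norm_pow]; exact pow_lt_one₀ (norm_nonneg _) hq two_ne_zero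
  have hodd : (∏' n : ℕ, (1 - (-q) ^ (2 * n + 1))) * (∏' n : ℕ, (1 - q ^ (2 * n + 1))) =
      ∏' n : ℕ, (1 - (q ^ 2) ^ (2 * n + 1)) := by
    rw [← (multipliable_one_sub_pow_odd hq').tprod_mul (multipliable_one_sub_pow_odd hq)]
    refine tprod_congr fun n ↦ ?_
    rw [Odd.neg_pow ⟨n, rfl⟩]
    ring
  have h4 := tprod_one_sub_pow_eq_odd_mul_even hq2
  rw [← hodd, show (q ^ 2) ^ 2 = q ^ 4 by ring] at h4
  rw [tprod_one_sub_pow_eq_odd_mul_even hq, tprod_one_sub_pow_eq_odd_mul_even hq', neg_sq, h4]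
  ring

/-- The eta quotient expression for `η (z + 1 / 2)`, at the level of sixth powers. -/
theorem dedekindEta_add_half_pow_six {z : ℂ} (hz : 0 < z.im) :
    dedekindEta (z + 1 / 2) ^ 6 * dedekindEta z ^ 6 * dedekindEta (4 * z) ^ 6 =
      Complex.exp (Real.pi * Complex.I / 4) * (dedekindEta (2 * z) ^ 6) ^ 3 := by
  have hq : ‖Complex.exp (2 * Real.pi * Complex.I * z)‖ < 1 :=
    UpperHalfPlane.norm_exp_two_pi_I_lt_one ⟨z, hz⟩
  have hneg : Complex.exp (2 * Real.pi * Complex.I * (z + 1 / 2)) =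
      -Complex.exp (2 * Real.pi * Complex.I * z) := by
    rw [show 2 * Real.pi * Complex.I * (z + 1 / 2) =
      2 * Real.pi * Complex.I * z + Real.pi * Complex.I by ring, Complex.exp_add,
      Complex.exp_pi_mul_I, mul_neg_one]
  have h2 : Complex.exp (2 * Real.pi * Complex.I * (2 * z)) =
      Complex.exp (2 * Real.pi * Complex.I * z) ^ 2 := by
    rw [← Complex.exp_nat_mul]; push_cast; ring_nf
  have h4 : Complex.exp (2 * Real.pi * Complex.I * (4 * z)) =
      Complex.exp (2 * Real.pi * Complex.I * z) ^ 4 := by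
    rw [← Complex.exp_nat_mul]; push_cast; ring_nf
  have hexp : Complex.exp (Real.pi * Complex.I * (z + 1 / 2) / 12) ^ 6 *
      Complex.exp (Real.pi * Complex.I * z / 12) ^ 6 *
      Complex.exp (Real.pi * Complex.I * (4 * z) / 12) ^ 6 =
      Complex.exp (Real.pi * Complex.I / 4) *
        (Complex.exp (Real.pi * Complex.I * (2 * z) / 12) ^ 6) ^ 3 := by
    simp only [← Complex.exp_nat_mul, ← Complex.exp_add]
    push_cast
    ring_nf
  have hprod := tprod_one_sub_neg_pow hq
  simp only [dedekindEta_eq_exp_mul_tprod_pow, hneg, h2, h4]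
  have h := congrArg₂ (· * ·) hexp (congrArg (· ^ 6) hprod)
  linear_combination h

theorem stmt17 :
    (dedekindEta ((-3 + Complex.I * Real.sqrt 15)/24) *
      dedekindEta (3 * ((-3 + Complex.I * Real.sqrt 15)/24)))^6 =
    -(dedekindEta (2 * ((-3 + Complex.I * Real.sqrt 15)/24)) *
      dedekindEta (6 * ((-3 + Complex.I * Real.sqrt 15)/24)))^6 := by
  set τ : ℂ := (-3 + Complex.I * Real.sqrt 15) / 24 with hτ
  have hs : (Real.sqrt 15 : ℂ) ^ 2 = 15 := by
    rw [← Complex.ofReal_pow, Real.sq_sqrt (by norm_num)]; norm_num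
  have hquad : 24 * τ ^ 2 + 6 * τ + 1 = 0 := by
    rw [hτ]
    linear_combination (1 / 24 : ℂ) * (Complex.I ^ 2 * hs + 15 * Complex.I_sq)
  have him : 0 < τ.im := by
    have : τ.im = Real.sqrt 15 / 24 := by
      rw [hτ, show (24 : ℂ) = ((24 : ℝ) : ℂ) by norm_num, Complex.div_ofReal_im]; simp
    rw [this]; positivity
  have hmul : ∀ n : ℕ, 0 < n → 0 < ((n : ℂ) * τ).im := fun n hn ↦ by
    simpa using mul_pos (Nat.cast_pos.2 hn) him
  have i2 : 0 < (2 * τ).im := hmul 2 (by norm_num)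
  have i3 : 0 < (3 * τ).im := hmul 3 (by norm_num)
  have i6 : 0 < (6 * τ).im := hmul 6 (by norm_num)
  have i12 : 0 < (12 * τ).im := hmul 12 (by norm_num)
  have hτ0 : τ ≠ 0 := by rintro h; simp [h] at him
  have h12 : dedekindEta (12 * τ) ^ 6 = -(2 * τ) ^ 3 * dedekindEta (2 * τ) ^ 6 := by
    have h := dedekindEta_neg_inv_pow_six i2
    rw [show -1 / (2 * τ) = 12 * τ + (3 : ℕ) by
      field_simp; push_cast; linear_combination -hquad, dedekindEta_add_nat_pow_six,
      Complex.I_pow_three] at h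
    apply mul_left_cancel₀ Complex.I_ne_zero
    linear_combination -h
  have h24 : dedekindEta (24 * τ) ^ 6 = -Complex.I * τ ^ 3 * dedekindEta τ ^ 6 := by
    have h := dedekindEta_neg_inv_pow_six him
    rw [show -1 / τ = 24 * τ + (6 : ℕ) by
      field_simp; push_cast; linear_combination -hquad, dedekindEta_add_nat_pow_six,
      show Complex.I ^ 6 = -1 by rw [show 6 = 4 + 2 from rfl, pow_add]; simp] at h
    linear_combination -h
  have hs0 : 6 * τ + 1 ≠ 0 := fun h ↦ by
    have := congrArg Complex.im h; simp at this; simp [this] at him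
  set s : ℂ := 6 * τ + 1 with hsdef
  set ζ : ℂ := Complex.exp (Real.pi * Complex.I / 4) with hζ
  have hζ2 : ζ ^ 2 = Complex.I := by
    rw [hζ, ← Complex.exp_nat_mul]
    refine Eq.trans ?_ Complex.exp_pi_div_two_mul_I
    push_cast; ring_nf
  have h6half : dedekindEta (6 * τ + 1 / 2) ^ 6 = -s ^ 3 * dedekindEta (6 * τ) ^ 6 := by
    have h := dedekindEta_neg_inv_pow_six (z := s) (by simpa [hsdef] using i6)
    rw [show -1 / s = 6 * τ + 1 / 2 by
      rw [div_eq_iff hs0, hsdef]; linear_combination (-3 / 2 : ℂ) * hquad] at h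
    rw [h, hsdef, dedekindEta_add_one_pow_six]
    linear_combination s ^ 3 * dedekindEta (6 * τ) ^ 6 * Complex.I_sq
  have h3half : Complex.I * dedekindEta (12 * τ) ^ 6 =
      Complex.I * (s / 2) ^ 3 * dedekindEta (3 * τ + 1 / 2) ^ 6 := by
    have h := dedekindEta_neg_inv_pow_six (z := 3 * τ + 1 / 2) (by simpa using i3)
    have hr : 3 * τ + 1 / 2 = s / 2 := by rw [hsdef]; ring
    rw [show -1 / (3 * τ + 1 / 2) = 12 * τ + 1 by
      rw [hr, div_eq_iff (div_ne_zero hs0 two_ne_zero), hsdef]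
      linear_combination (-3 / 2 : ℂ) * hquad, dedekindEta_add_one_pow_six] at h
    rw [h, hr]
  have hA := dedekindEta_add_half_pow_six i6
  have hB := dedekindEta_add_half_pow_six i3
  rw [show 4 * (6 * τ) = 24 * τ by ring, show 2 * (6 * τ) = 12 * τ by ring, h6half] at hA
  rw [show 4 * (3 * τ) = 12 * τ by ring, show 2 * (3 * τ) = 6 * τ by ring] at hB
  have n6 := pow_ne_zero 6 (dedekindEta_ne_zero i6)
  have n12 := pow_ne_zero 6 (dedekindEta_ne_zero i12)
  rw [mul_pow, mul_pow]
  have h3cancel := mul_left_cancel₀ (a := Complex.I) Complex.I_ne_zero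
    (h3half.trans (mul_assoc _ _ _))
  generalize dedekindEta (3 * τ + 1 / 2) ^ 6 = H at *
  generalize dedekindEta τ ^ 6 = E1 at *
  generalize dedekindEta (2 * τ) ^ 6 = E2 at *
  generalize dedekindEta (3 * τ) ^ 6 = E3 at *
  generalize dedekindEta (6 * τ) ^ 6 = E6 at *
  generalize dedekindEta (12 * τ) ^ 6 = E12 at *
  generalize dedekindEta (24 * τ) ^ 6 = E24 at *
  have hC : E12 ^ 2 * E3 = ζ * (s / 2) ^ 3 * E6 ^ 3 := by
    linear_combination (s / 2) ^ 3 * hB + E12 * E3 * h3cancel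
  have hD : ζ ^ 2 * (s / 2) ^ 3 * E12 * E6 = -s ^ 3 * E24 * E3 := by
    apply mul_left_cancel₀ (mul_ne_zero (pow_ne_zero 2 n12) (pow_ne_zero 2 n6))
    linear_combination - ζ * (s / 2) ^ 3 * E6 ^ 3 * hA + s ^ 3 * E6 ^ 2 * E24 * hC
  rw [hζ2, h12, h24] at hD
  apply mul_left_cancel₀ (mul_ne_zero Complex.I_ne_zero
    (mul_ne_zero (pow_ne_zero 3 hs0) (pow_ne_zero 3 hτ0)))
  linear_combination -hD
end
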